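/- arXiv:0806.0016 — 3 statements merged into one kernel-verified Lean document; each statement's English description precedes it below -/
import Mathlib

section
/- Let (M,g) be an (n+1)-dimensional Lorentzian manifold satisfying the vacuum Einstein equations with cosmological constant (Ric = λ g), admitting n-1 linearly independent commuting Killing vector fields K₀, …, K_{n-2}. If the set {p ∈ M : (K₀ ∧ … ∧ K_{n-2})|_p = 0} is non-empty, then the orthogonal-integrability condition dK_μ ∧ K₀ ∧ … ∧ K_{n-2} = 0 holds on M for each μ. -/
open Finset

noncomputable section

/-- Points of the (flat chart of the) manifold. -/
abbrev Vec (n : ℕ) := Fin n → ℝ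

/-- A `k`-form field: at each point, a function of `k` vectors. -/
abbrev FormField (n k : ℕ) := Vec n → (Fin k → Vec n) → ℝ

/-- Wedge product of form fields. -/
def wedge {n k l : ℕ} (α : FormField n k) (β : FormField n l) : FormField n (k + l) :=
  fun x v => ((k.factorial : ℝ) * (l.factorial : ℝ))⁻¹ *
    ∑ σ : Equiv.Perm (Fin (k + l)),
      ((Equiv.Perm.sign σ : ℤ) : ℝ) *
        (α x fun i => v (σ (Fin.castAdd l i))) *
        (β x fun j => v (σ (Fin.natAdd k j)))

/-- Exterior derivative of a form field, in flat coordinates. -/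
def extd {n k : ℕ} (ω : FormField n k) : FormField n (k + 1) :=
  fun x v => ∑ i : Fin (k + 1),
    (-1 : ℝ) ^ (i : ℕ) *
      fderiv ℝ (fun y => ω y (fun j => v (i.succAbove j))) x (v i)

/-- Coordinate partial derivative of a scalar field. -/
def pd {n : ℕ} (f : Vec n → ℝ) (a : Fin n) (x : Vec n) : ℝ :=
  fderiv ℝ f x (Pi.single a 1)

/-- Christoffel symbols `Γ^a_{bc}` of the metric `g` (with pointwise inverse `ginv`). -/
def christoffel {n : ℕ} (g ginv : Vec n → Fin n → Fin n → ℝ)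
    (x : Vec n) (a b c : Fin n) : ℝ :=
  (1 / 2) * ∑ d, ginv x a d *
    (pd (fun y => g y d c) b x + pd (fun y => g y b d) c x - pd (fun y => g y b c) d x)

/-- Ricci tensor `R_{bc} = ∂_aΓ^a_{bc} - ∂_bΓ^a_{ac} + Γ^a_{ad}Γ^d_{bc} - Γ^a_{bd}Γ^d_{ac}`. -/
def ricci {n : ℕ} (g ginv : Vec n → Fin n → Fin n → ℝ) (x : Vec n) (b c : Fin n) : ℝ :=
  (∑ a, pd (fun y => christoffel g ginv y a b c) a x)
    - (∑ a, pd (fun y => christoffel g ginv y a a c) b x)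
    + (∑ a, ∑ d, christoffel g ginv x a a d * christoffel g ginv x d b c)
    - (∑ a, ∑ d, christoffel g ginv x a b d * christoffel g ginv x d a c)

/-! ### Determinants with prescribed rows -/

/-- A matrix acts on the determinant as a derivation, through its trace. -/
theorem sum_det_update_mulVec {N : ℕ} (A : Matrix (Fin N) (Fin N) ℝ) (r : Fin N → Vec N) :
    ∑ i, Matrix.detRowAlternating (Function.update r i (A.mulVec (r i)))
      = A.trace * Matrix.detRowAlternating r := by
  have h : ∀ i, Matrix.detRowAlternating (Function.update r i (A.mulVec (r i)))
      = ((Matrix.of r * A.transpose) * Matrix.adjugate (Matrix.of r)) i i := fun i => by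
    have h1 := congrFun (Matrix.cramer_eq_adjugate_mulVec
      (Matrix.of r).transpose (A.mulVec (r i))) i
    rw [Matrix.cramer_transpose_apply, ← Matrix.adjugate_transpose] at h1
    refine h1.trans ?_
    rw [Matrix.mulVec_transpose, Matrix.mul_apply, Matrix.vecMul, dotProduct]
    refine Finset.sum_congr rfl fun j _ => ?_
    congr 1
    simp only [Matrix.mulVec, dotProduct, Matrix.mul_apply, Matrix.of_apply,
      Matrix.transpose_apply]
    exact Finset.sum_congr rfl fun k _ => mul_comm _ _
  calc _ = Matrix.trace ((Matrix.of r * A.transpose) * Matrix.adjugate (Matrix.of r)) :=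
        Finset.sum_congr rfl fun i _ => h i
    _ = _ := by
      rw [Matrix.trace_mul_comm, ← mul_assoc, Matrix.adjugate_mul, Matrix.smul_mul, one_mul,
        Matrix.trace_smul, Matrix.trace_transpose, smul_eq_mul, mul_comm]
      rfl

theorem update_append_natAdd {α : Type*} {k m : ℕ} (u : Fin k → α) (v : Fin m → α) (j : Fin m)
    (z : α) :
    Function.update (Fin.append u v) (Fin.natAdd k j) z
      = Fin.append u (Function.update v j z) := by
  ext i
  refine Fin.addCases (fun i => ?_) (fun i => ?_) i
  · have : Fin.castAdd m i ≠ Fin.natAdd k j := by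
      intro h; have := congrArg Fin.val h; simp at this; omega
    simp [Function.update_of_ne this]
  · by_cases h : i = j
    · subst h; simp
    · have : Fin.natAdd k i ≠ Fin.natAdd k j := by simpa using h
      simp [Function.update_of_ne this, Function.update_of_ne h]

theorem update_append_castAdd {α : Type*} {k m : ℕ} (u : Fin k → α) (v : Fin m → α) (j : Fin k)
    (z : α) :
    Function.update (Fin.append u v) (Fin.castAdd m j) z
      = Fin.append (Function.update u j z) v := by
  ext i
  refine Fin.addCases (fun i => ?_) (fun i => ?_) i
  · by_cases h : i = j
    · subst h; simp
    · have : Fin.castAdd m i ≠ Fin.castAdd m j := by simpa using h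
      simp [Function.update_of_ne this, Function.update_of_ne h]
  · have : Fin.natAdd k i ≠ Fin.castAdd m j := by
      intro h; have := congrArg Fin.val h; simp at this; omega
    simp [Function.update_of_ne this]

/-- The contraction `ε_{a b c₁ … c_m} F^{ab} v₁^{c₁} ⋯ v_m^{c_m}` of a bivector and `m` vectors with
the Levi-Civita symbol. -/
def bivDet {m : ℕ} (F : Matrix (Fin (2 + m)) (Fin (2 + m)) ℝ) (v : Fin m → Vec (2 + m)) : ℝ :=
  ∑ a, ∑ b, F a b *
    Matrix.detRowAlternating (Fin.append ![(Pi.single a 1 : Vec (2 + m)), Pi.single b 1] v)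

section bivDet

variable {m : ℕ}

theorem bivDet_sum {ι : Type*} (s : Finset ι) (F : ι → Matrix (Fin (2 + m)) (Fin (2 + m)) ℝ)
    (v : Fin m → Vec (2 + m)) : bivDet (∑ i ∈ s, F i) v = ∑ i ∈ s, bivDet (F i) v := by
  simp only [bivDet, Matrix.sum_apply, Finset.sum_mul]
  rw [Finset.sum_comm (s := s)]
  exact Finset.sum_congr rfl fun a _ => Finset.sum_comm

theorem bivDet_add (F F' : Matrix (Fin (2 + m)) (Fin (2 + m)) ℝ)
    (v : Fin m → Vec (2 + m)) : bivDet (F + F') v = bivDet F v + bivDet F' v := by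
  simp only [bivDet, Matrix.add_apply, add_mul, Finset.sum_add_distrib]

theorem bivDet_smul (c : ℝ) (F : Matrix (Fin (2 + m)) (Fin (2 + m)) ℝ)
    (v : Fin m → Vec (2 + m)) : bivDet (c • F) v = c * bivDet F v := by
  simp only [bivDet, Matrix.smul_apply, smul_eq_mul, mul_assoc, Finset.mul_sum]

theorem bivDet_update_smul (F : Matrix (Fin (2 + m)) (Fin (2 + m)) ℝ)
    (v : Fin m → Vec (2 + m)) (j : Fin m) (c : ℝ) (z : Vec (2 + m)) :
    bivDet F (Function.update v j (c • z)) = c * bivDet F (Function.update v j z) := by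
  simp only [bivDet, ← update_append_natAdd, AlternatingMap.map_update_smul, Finset.mul_sum,
    smul_eq_mul]
  exact Finset.sum_congr rfl fun a _ => Finset.sum_congr rfl fun b _ => by ring

/-- Exchanging two vectors changes the sign. -/
theorem bivDet_update_update (F : Matrix (Fin (2 + m)) (Fin (2 + m)) ℝ)
    (v : Fin m → Vec (2 + m)) {i j : Fin m} (hij : i ≠ j) (y z : Vec (2 + m)) :
    bivDet F (Function.update (Function.update v i y) j z)
      = - bivDet F (Function.update (Function.update v j y) i z) := by
  simp only [bivDet, ← Finset.sum_neg_distrib]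
  refine Finset.sum_congr rfl fun a _ => Finset.sum_congr rfl fun b _ => ?_
  have hne : (Fin.natAdd 2 i) ≠ Fin.natAdd 2 j := by simpa using hij
  have key := Matrix.detRowAlternating.map_swap (R := ℝ)
    (Function.update (Function.update
    (Fin.append ![(Pi.single a 1 : Vec (2 + m)), Pi.single b 1] v)
      (Fin.natAdd 2 j) y) (Fin.natAdd 2 i) z) hne
  rw [← update_append_natAdd, ← update_append_natAdd, ← update_append_natAdd,
    ← update_append_natAdd, ← mul_neg, ← key]
  congr 2
  ext k : 1
  by_cases hi : k = Fin.natAdd 2 i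
  · subst hi
    simp [hne, hne.symm]
  · by_cases hj : k = Fin.natAdd 2 j
    · subst hj
      simp
    · simp [Equiv.swap_apply_of_ne_of_ne hi hj, Function.update_of_ne hi,
        Function.update_of_ne hj]

theorem append_pair_left (F : Vec (2 + m)) (w : Vec (2 + m)) (v : Fin m → Vec (2 + m)) :
    Matrix.detRowAlternating (Fin.append ![F, w] v)
      = ∑ a, F a * Matrix.detRowAlternating (Fin.append ![(Pi.single a 1 : Vec (2 + m)), w] v) := by
  have h : ∀ z : Vec (2 + m), Fin.append ![z, w] v
      = Function.update (Fin.append ![0, w] v) (Fin.castAdd m 0) z := fun z => by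
    rw [update_append_castAdd]; congr 1; ext i : 1; fin_cases i <;> rfl
  conv_lhs => rw [h, pi_eq_sum_univ' F, AlternatingMap.map_update_sum]
  refine Finset.sum_congr rfl fun a _ => ?_
  rw [AlternatingMap.map_update_smul, h (Pi.single a 1), smul_eq_mul]

theorem append_pair_right (F : Vec (2 + m)) (w : Vec (2 + m)) (v : Fin m → Vec (2 + m)) :
    Matrix.detRowAlternating (Fin.append ![w, F] v)
      = ∑ a, F a * Matrix.detRowAlternating (Fin.append ![w, (Pi.single a 1 : Vec (2 + m))] v) := by
  have h : ∀ z : Vec (2 + m), Fin.append ![w, z] v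
      = Function.update (Fin.append ![w, 0] v) (Fin.castAdd m 1) z := fun z => by
    rw [update_append_castAdd]; congr 1; ext i : 1; fin_cases i <;> rfl
  conv_lhs => rw [h, pi_eq_sum_univ' F, AlternatingMap.map_update_sum]
  refine Finset.sum_congr rfl fun a _ => ?_
  rw [AlternatingMap.map_update_smul, h (Pi.single a 1), smul_eq_mul]

theorem bivDet_vecMulVec (y z : Vec (2 + m)) (v : Fin m → Vec (2 + m)) :
    bivDet (Matrix.vecMulVec y z) v
      = Matrix.detRowAlternating (Fin.append ![y, z] v) := by
  rw [append_pair_left, bivDet]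
  refine Finset.sum_congr rfl fun a _ => ?_
  rw [append_pair_right, Finset.mul_sum]
  exact Finset.sum_congr rfl fun b _ => by rw [Matrix.vecMulVec_apply]; ring

theorem bivDet_vecMulVec_left (y : Vec (2 + m)) (v : Fin m → Vec (2 + m)) (μ : Fin m) :
    bivDet (Matrix.vecMulVec (v μ) y) v = 0 := by
  rw [bivDet_vecMulVec]
  exact AlternatingMap.map_eq_zero_of_eq _ _ (i := Fin.castAdd m 0) (j := Fin.natAdd 2 μ)
    (by simp) (by intro h; have := congrArg Fin.val h; simp at this; omega)

theorem bivDet_vecMulVec_right (y : Vec (2 + m)) (v : Fin m → Vec (2 + m)) (μ : Fin m) :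
    bivDet (Matrix.vecMulVec y (v μ)) v = 0 := by
  rw [bivDet_vecMulVec]
  exact AlternatingMap.map_eq_zero_of_eq _ _ (i := Fin.castAdd m 1) (j := Fin.natAdd 2 μ)
    (by simp) (by intro h; have := congrArg Fin.val h; simp at this; omega)

/-- The derivation property of `bivDet` under the action of a matrix. -/
theorem bivDet_derivation (A F : Matrix (Fin (2 + m)) (Fin (2 + m)) ℝ)
    (v : Fin m → Vec (2 + m)) :
    bivDet (A * F + F * A.transpose) v + ∑ j, bivDet F (Function.update v j (A.mulVec (v j)))
      = A.trace * bivDet F v := by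
  have h1 : bivDet (A * F) v = ∑ a, ∑ b, F a b * Matrix.detRowAlternating
      (Fin.append ![A.mulVec (Pi.single a 1), (Pi.single b 1 : Vec (2 + m))] v) := by
    rw [bivDet]
    simp only [Matrix.mul_apply, Finset.sum_mul]
    simp_rw [append_pair_left (A.mulVec _), Matrix.mulVec_single_one, Matrix.col_apply,
      Finset.mul_sum]
    rw [Finset.sum_comm, Finset.sum_comm (s := univ) (t := univ) (f := fun a b => ∑ i, F a b * _)]
    refine Finset.sum_congr rfl fun b _ => ?_
    rw [Finset.sum_comm]
    exact Finset.sum_congr rfl fun a _ => Finset.sum_congr rfl fun c _ => by ring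
  have h2 : bivDet (F * A.transpose) v = ∑ a, ∑ b, F a b * Matrix.detRowAlternating
      (Fin.append ![(Pi.single a 1 : Vec (2 + m)), A.mulVec (Pi.single b 1)] v) := by
    rw [bivDet]
    simp only [Matrix.mul_apply, Finset.sum_mul, Matrix.transpose_apply]
    simp_rw [append_pair_right (A.mulVec _), Matrix.mulVec_single_one, Matrix.col_apply,
      Finset.mul_sum]
    refine Finset.sum_congr rfl fun b _ => ?_
    rw [Finset.sum_comm]
    exact Finset.sum_congr rfl fun a _ => Finset.sum_congr rfl fun c _ => by ring
  have h3 : ∑ j, bivDet F (Function.update v j (A.mulVec (v j)))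
      = ∑ a, ∑ b, F a b * ∑ j, Matrix.detRowAlternating
      (Fin.append ![(Pi.single a 1 : Vec (2 + m)), Pi.single b 1]
        (Function.update v j (A.mulVec (v j)))) := by
    simp only [bivDet, Finset.mul_sum]
    rw [Finset.sum_comm]
    exact Finset.sum_congr rfl fun a _ => Finset.sum_comm
  rw [bivDet_add, h1, h2, h3, bivDet, Finset.mul_sum, ← Finset.sum_add_distrib,
    ← Finset.sum_add_distrib]
  refine Finset.sum_congr rfl fun a _ => ?_
  rw [Finset.mul_sum, ← Finset.sum_add_distrib, ← Finset.sum_add_distrib]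
  refine Finset.sum_congr rfl fun b _ => ?_
  have key := sum_det_update_mulVec A
    (Fin.append ![(Pi.single a 1 : Vec (2 + m)), Pi.single b 1] v)
  rw [Fin.sum_univ_add, Fin.sum_univ_two] at key
  simp only [update_append_castAdd, update_append_natAdd, Fin.append_left, Fin.append_right]
    at key
  have u0 : ∀ y z w : Vec (2 + m), Function.update ![y, z] 0 w = ![w, z] := fun y z w => by
    ext i : 1; fin_cases i <;> rfl
  have u1 : ∀ y z w : Vec (2 + m), Function.update ![y, z] 1 w = ![y, w] := fun y z w => by
    ext i : 1; fin_cases i <;> rfl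
  rw [u0, u1] at key
  simp only [Matrix.cons_val_zero, Matrix.cons_val_one] at key
  rw [← mul_add, ← mul_add, key]
  ring

end bivDet


/-- The pointwise algebra behind the constancy of the twist: a bivector `F` with covariant
derivative `E`, invariant under commuting fields `X i` with Jacobians `J i`, and with
divergence proportional to one of these fields. -/
theorem bivDet_add_sum_update_eq_zero {m : ℕ} (F : Matrix (Fin (2 + m)) (Fin (2 + m)) ℝ)
    (E : Fin (2 + m) → Matrix (Fin (2 + m)) (Fin (2 + m)) ℝ)
    (X : Fin m → Vec (2 + m)) (J : Fin m → Matrix (Fin (2 + m)) (Fin (2 + m)) ℝ)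
    (μ : Fin m) (l : ℝ)
    (hdiv : ∀ b, ∑ a, E a a b = l * X μ b)
    (hanti : ∀ d a b, E d a b = - E d b a)
    (hinv : ∀ i, ∑ d, X i d • E d = J i * F + F * (J i).transpose - (J i).trace • F)
    (hcomm : ∀ i j, (J i).mulVec (X j) = (J j).mulVec (X i)) (e : Fin (2 + m)) :
    bivDet (E e) X + ∑ i, bivDet F (Function.update X i ((J i).mulVec (Pi.single e 1))) = 0 := by
  set ee : Vec (2 + m) := Pi.single e 1 with hee
  set P : Fin (2 + m) → Matrix (Fin (2 + m)) (Fin (2 + m)) ℝ :=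
    fun d => Matrix.vecMulVec ee (Pi.single d 1) with hP
  have hPX : ∀ d j, (P d).mulVec (X j) = X j d • ee := fun d j => by
    ext a
    simp [hP, Matrix.mulVec, dotProduct, Matrix.vecMulVec_apply, Pi.single_apply, mul_comm]
  have htr : ∀ d, (P d).trace = if d = e then 1 else 0 := fun d => by
    simp [hP, hee, Matrix.trace, Matrix.vecMulVec_apply, Pi.single_apply]
  have hPE : ∑ d, (P d * E d + E d * (P d).transpose)
      = l • (Matrix.vecMulVec ee (X μ)) + (-l) • Matrix.vecMulVec (X μ) ee := by
    rw [Finset.sum_add_distrib]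
    congr 1
    · ext a b
      simp only [hP, Matrix.sum_apply, Matrix.mul_apply, Matrix.vecMulVec_apply,
        Matrix.smul_apply, smul_eq_mul, Pi.single_apply, mul_ite, mul_one, mul_zero, ite_mul,
        zero_mul, Finset.sum_ite_eq', Finset.mem_univ, if_true]
      rw [← Finset.mul_sum, hdiv]
      ring
    · ext a b
      simp only [hP, Matrix.sum_apply, Matrix.mul_apply, Matrix.vecMulVec_apply,
        Matrix.smul_apply, smul_eq_mul, Pi.single_apply, mul_ite, mul_one, mul_zero,
        Finset.sum_ite_eq', Finset.mem_univ, if_true,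
        Matrix.transpose_apply]
      rw [← Finset.sum_mul, Finset.sum_congr rfl fun d _ => hanti d a d,
        Finset.sum_neg_distrib, hdiv]
      ring
  have h1 : bivDet (E e) X = ∑ j, bivDet (∑ d, X j d • E d) (Function.update X j ee) := by
    calc bivDet (E e) X = ∑ d, (P d).trace * bivDet (E d) X := by simp [htr]
      _ = ∑ d, (bivDet (P d * E d + E d * (P d).transpose) X
            + ∑ j, bivDet (E d) (Function.update X j ((P d).mulVec (X j)))) :=
          Finset.sum_congr rfl fun d _ => (bivDet_derivation _ _ _).symm
      _ = ∑ d, ∑ j, bivDet (E d) (Function.update X j ((P d).mulVec (X j))) := by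
          rw [Finset.sum_add_distrib, ← bivDet_sum, hPE, bivDet_add, bivDet_smul, bivDet_smul,
            bivDet_vecMulVec_left, bivDet_vecMulVec_right]
          ring
      _ = _ := by
          rw [Finset.sum_comm]
          simp only [bivDet_sum, hPX, bivDet_smul, bivDet_update_smul]
  have h2 : ∀ j, bivDet (∑ d, X j d • E d) (Function.update X j ee)
      = - ∑ k, bivDet F (Function.update (Function.update X j ee) k
          ((J j).mulVec (Function.update X j ee k))) := fun j => by
    rw [hinv, sub_eq_add_neg, ← neg_smul, bivDet_add, bivDet_smul]
    linarith [bivDet_derivation (J j) F (Function.update X j ee)]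
  set T : Fin m → Fin m → ℝ := fun j k => if j = k then 0 else
    bivDet F (Function.update (Function.update X j ee) k ((J j).mulVec (X k))) with hT
  have h3 : ∀ j, ∑ k, bivDet F (Function.update (Function.update X j ee) k
          ((J j).mulVec (Function.update X j ee k)))
      = bivDet F (Function.update X j ((J j).mulVec ee)) + ∑ k, T j k := fun j => by
    rw [← Finset.add_sum_erase _ _ (Finset.mem_univ j),
      ← Finset.add_sum_erase _ (T j) (Finset.mem_univ j)]
    have : T j j = 0 := by simp [hT]
    rw [this, zero_add, Function.update_self, Function.update_idem]
    congr 1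
    refine Finset.sum_congr rfl fun k hk => ?_
    have hkj := Finset.ne_of_mem_erase hk
    simp only [hT]
    rw [if_neg hkj.symm, Function.update_of_ne hkj]
  have h4 : ∑ j, ∑ k, T j k = 0 := by
    have hTT : ∀ j k, T j k = - T k j := fun j k => by
      by_cases h : j = k
      · subst h; simp [hT]
      · simp only [hT, if_neg h, if_neg (Ne.symm h)]
        rw [bivDet_update_update F X h, hcomm]
    have h5 : ∑ j, ∑ k, T j k = - ∑ j, ∑ k, T j k := by
      conv_lhs => rw [Finset.sum_comm]
      simp only [← Finset.sum_neg_distrib]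
      exact Finset.sum_congr rfl fun k _ => Finset.sum_congr rfl fun j _ => hTT j k
    linarith
  rw [h1, Finset.sum_congr rfl fun j _ => h2 j, Finset.sum_neg_distrib,
    Finset.sum_congr rfl fun j _ => h3 j, Finset.sum_add_distrib, h4]
  ring


/-! ### Calculus of coordinate partial derivatives -/

section pd

variable {N : ℕ}

theorem pd_add {f h : Vec N → ℝ} {x : Vec N} (hf : DifferentiableAt ℝ f x)
    (hh : DifferentiableAt ℝ h x) (a : Fin N) :
    pd (fun y => f y + h y) a x = pd f a x + pd h a x := by
  simp only [pd]
  rw [fderiv_fun_add hf hh]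
  rfl

theorem pd_sub {f h : Vec N → ℝ} {x : Vec N} (hf : DifferentiableAt ℝ f x)
    (hh : DifferentiableAt ℝ h x) (a : Fin N) :
    pd (fun y => f y - h y) a x = pd f a x - pd h a x := by
  simp only [pd]
  rw [fderiv_fun_sub hf hh]
  rfl

theorem pd_mul {f h : Vec N → ℝ} {x : Vec N} (hf : DifferentiableAt ℝ f x)
    (hh : DifferentiableAt ℝ h x) (a : Fin N) :
    pd (fun y => f y * h y) a x = pd f a x * h x + f x * pd h a x := by
  simp only [pd]
  rw [fderiv_fun_mul hf hh]
  simp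
  ring

theorem pd_const (c : ℝ) (a : Fin N) (x : Vec N) : pd (fun _ => c) a x = 0 := by
  simp [pd]

theorem pd_const_mul {f : Vec N → ℝ} {x : Vec N} (c : ℝ) (hf : DifferentiableAt ℝ f x)
    (a : Fin N) : pd (fun y => c * f y) a x = c * pd f a x := by
  rw [pd_mul (differentiableAt_const c) hf, pd_const]
  ring

theorem pd_sum {ι : Type*} (s : Finset ι) {f : ι → Vec N → ℝ} {x : Vec N}
    (hf : ∀ i ∈ s, DifferentiableAt ℝ (f i) x) (a : Fin N) :
    pd (fun y => ∑ i ∈ s, f i y) a x = ∑ i ∈ s, pd (f i) a x := by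
  simp only [pd]
  rw [fderiv_fun_sum hf]
  simp

theorem fderiv_apply_eq_sum_pd (f : Vec N → ℝ) (x v : Vec N) :
    fderiv ℝ f x v = ∑ a, v a * pd f a x := by
  conv_lhs => rw [pi_eq_sum_univ' v]
  simp [pd]

theorem contDiff_pd {f : Vec N → ℝ} (hf : ContDiff ℝ (⊤ : ℕ∞) f) (a : Fin N) :
    ContDiff ℝ (⊤ : ℕ∞) (pd f a) :=
  (hf.fderiv_right (m := (⊤ : ℕ∞)) (by simp)).clm_apply contDiff_const

theorem differentiableAt_of_contDiff {f : Vec N → ℝ} (hf : ContDiff ℝ (⊤ : ℕ∞) f) {x : Vec N} :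
    DifferentiableAt ℝ f x :=
  (hf.differentiable (by simp)).differentiableAt

theorem pd_comm {f : Vec N → ℝ} (hf : ContDiff ℝ (⊤ : ℕ∞) f) (a b : Fin N) (x : Vec N) :
    pd (pd f a) b x = pd (pd f b) a x := by
  have hs : IsSymmSndFDerivAt ℝ f x := hf.contDiffAt.isSymmSndFDerivAt <| by
    rw [minSmoothness_of_isRCLikeNormedField]
    exact WithTop.coe_le_coe.2 le_top
  have hd : DifferentiableAt ℝ (fderiv ℝ f) x :=
    ((hf.fderiv_right (m := (⊤ : ℕ∞)) (by simp)).differentiable (by simp)).differentiableAt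
  have h : ∀ a b, pd (pd f a) b x
      = fderiv ℝ (fderiv ℝ f) x (Pi.single b 1) (Pi.single a 1) := fun a b => by
    change fderiv ℝ (fun y => fderiv ℝ f y (Pi.single a 1)) x _ = _
    rw [fderiv_clm_apply hd (differentiableAt_const _)]
    simp
  rw [h, h, hs.eq]

/-- Entrywise partial derivative of a matrix field. -/
def matPd {p q : Type*} (M : Vec N → Matrix p q ℝ) (c : Fin N) (x : Vec N) : Matrix p q ℝ :=
  Matrix.of fun a b => pd (fun y => M y a b) c x

theorem matPd_mul {p q r : Type*} [Fintype q] {M : Vec N → Matrix p q ℝ}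
    {L : Vec N → Matrix q r ℝ} {x : Vec N}
    (hM : ∀ a b, DifferentiableAt ℝ (fun y => M y a b) x)
    (hL : ∀ a b, DifferentiableAt ℝ (fun y => L y a b) x) (c : Fin N) :
    matPd (fun y => M y * L y) c x = matPd M c x * L x + M x * matPd L c x := by
  ext a b
  simp only [matPd, Matrix.of_apply, Matrix.add_apply, Matrix.mul_apply]
  rw [pd_sum (f := fun i y => M y a i * L y i b) _ fun i _ => (hM a i).mul (hL i b),
    ← Finset.sum_add_distrib]
  exact Finset.sum_congr rfl fun i _ => pd_mul (hM a i) (hL i b) c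

theorem contDiff_det {p : Type*} [Fintype p] [DecidableEq p] {r : Vec N → p → p → ℝ}
    (hr : ∀ a b, ContDiff ℝ (⊤ : ℕ∞) fun y => r y a b) :
    ContDiff ℝ (⊤ : ℕ∞) fun y => Matrix.detRowAlternating (r y) := by
  have h : ∀ y, Matrix.detRowAlternating (r y)
      = ∑ σ : Equiv.Perm p, ((Equiv.Perm.sign σ : ℤ) : ℝ) * ∏ i, r y (σ i) i :=
    fun y => Matrix.det_apply' (r y)
  simp only [h]
  exact ContDiff.sum fun σ _ => contDiff_const.mul (contDiff_prod fun i _ => hr _ _)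

theorem contDiff_matrix_inv {p : Type*} [Fintype p] [DecidableEq p] {M : Vec N → Matrix p p ℝ}
    (hM : ∀ a b, ContDiff ℝ (⊤ : ℕ∞) fun y => M y a b) (hdet : ∀ x, (M x).det ≠ 0) (a b : p) :
    ContDiff ℝ (⊤ : ℕ∞) fun y => (M y)⁻¹ a b := by
  have : (fun y => (M y)⁻¹ a b) = fun y => (M y).det⁻¹ * (M y).adjugate a b := by
    ext y
    rw [Matrix.inv_def, Matrix.smul_apply, smul_eq_mul, Ring.inverse_eq_inv']
  rw [this]
  refine ((contDiff_det hM).inv hdet).mul ?_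
  simp only [Matrix.adjugate_apply]
  refine contDiff_det fun i j => ?_
  by_cases h : i = b
  · subst h; simpa using contDiff_const
  · simpa [Matrix.updateRow_ne h] using hM i j

/-- Differentiating a determinant row by row. -/
theorem pd_det {M : ℕ} {r : Vec N → Fin M → Vec M} {x : Vec N}
    (hr : ∀ i j, DifferentiableAt ℝ (fun y => r y i j) x) (e : Fin N) :
    pd (fun y => Matrix.detRowAlternating (r y)) e x
      = ∑ i, Matrix.detRowAlternating
          (Function.update (r x) i fun j => pd (fun y => r y i j) e x) := by
  let D : ContinuousMultilinearMap ℝ (fun _ : Fin M => Vec M) ℝ :=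
    { (Matrix.detRowAlternating (R := ℝ) (n := Fin M)).toMultilinearMap with
      cont := by
        change Continuous fun A : Matrix (Fin M) (Fin M) ℝ => A.det
        exact continuous_id.matrix_det }
  have hd : HasFDerivAt r (ContinuousLinearMap.pi fun i => ContinuousLinearMap.pi fun j =>
      fderiv ℝ (fun y => r y i j) x) x :=
    hasFDerivAt_pi.2 fun i => hasFDerivAt_pi.2 fun j => (hr i j).hasFDerivAt
  have := ((D.hasFDerivAt (r x)).comp x hd).fderiv
  change fderiv ℝ (D ∘ r) x _ = _
  rw [this]
  simp only [ContinuousLinearMap.comp_apply, ContinuousMultilinearMap.linearDeriv_apply]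
  rfl

end pd

/-- A function whose gradient is proportional to it vanishes everywhere if it vanishes once. -/
theorem eq_zero_of_pd_eq_mul {N : ℕ} {f : Vec N → ℝ} (hf : Differentiable ℝ f)
    {c : Fin N → Vec N → ℝ} (hc : ∀ e, Continuous (c e))
    (h : ∀ e x, pd f e x = c e x * f x) {p : Vec N} (hp : f p = 0) (x : Vec N) : f x = 0 := by
  set γ : ℝ → Vec N := fun t => p + t • (x - p) with hγ
  set k : ℝ → ℝ := fun t => ∑ e, (x - p) e * c e (γ t) with hk
  have hγc : Continuous γ := by fun_prop
  have hkc : Continuous k :=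
    continuous_finsetSum _ fun e _ => continuous_const.mul ((hc e).comp hγc)
  have hγd : ∀ t, HasDerivAt γ (x - p) t := fun t =>
    (((hasDerivAt_id t).smul_const (x - p)).const_add p).congr_deriv (by simp)
  have hφ : ∀ t, HasDerivAt (f ∘ γ) (k t * f (γ t)) t := fun t => by
    have := (hf (γ t)).hasFDerivAt.comp_hasDerivAt t (hγd t)
    rw [fderiv_apply_eq_sum_pd] at this
    refine this.congr_deriv ?_
    simp only [hk]
    rw [Finset.sum_mul]
    exact Finset.sum_congr rfl fun e _ => by rw [h]; ring
  have hI : ∀ t, HasDerivAt (fun t => ∫ s in (0 : ℝ)..t, k s) (k t) t := fun t =>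
    (hkc.integral_hasStrictDerivAt 0 t).hasDerivAt
  have hψ : ∀ t, HasDerivAt
      (fun t => (f ∘ γ) t * Real.exp (-∫ s in (0 : ℝ)..t, k s)) 0 t := fun t => by
    refine ((hφ t).mul (hI t).neg.exp).congr_deriv ?_
    simp only [Function.comp]
    ring
  have := is_const_of_deriv_eq_zero (fun t => (hψ t).differentiableAt)
    (fun t => (hψ t).deriv) 1 0
  simpa [hγ, hp, Real.exp_ne_zero] using this


/-! ### Killing fields of a metric in coordinates -/

section metric

variable {N : ℕ} {g ginv : Vec N → Fin N → Fin N → ℝ} {X Y : Vec N → Vec N}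

/-- Lowering the index of a vector field. -/
def lower (g : Vec N → Fin N → Fin N → ℝ) (X : Vec N → Vec N) (b : Fin N) (x : Vec N) : ℝ :=
  ∑ a, g x a b * X x a

/-- The matrix of the exterior derivative of the one-form dual to a vector field. -/
def curl (g : Vec N → Fin N → Fin N → ℝ) (X : Vec N → Vec N) (x : Vec N) :
    Matrix (Fin N) (Fin N) ℝ :=
  Matrix.of fun a b => pd (lower g X b) a x - pd (lower g X a) b x

/-- The Jacobian matrix of a vector field. -/
def jac (X : Vec N → Vec N) (x : Vec N) : Matrix (Fin N) (Fin N) ℝ :=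
  Matrix.of fun a b => pd (fun y => X y a) b x

/-- The exterior derivative of the dual one-form, with indices raised. -/
def curlUp (g ginv : Vec N → Fin N → Fin N → ℝ) (X : Vec N → Vec N) (x : Vec N) :
    Matrix (Fin N) (Fin N) ℝ :=
  Matrix.of (ginv x) * curl g X x * Matrix.of (ginv x)

/-- The contracted Christoffel symbol `Γ^a_{ac}`. -/
def christoffelTrace (g ginv : Vec N → Fin N → Fin N → ℝ) (c : Fin N) (x : Vec N) : ℝ :=
  ∑ a, christoffel g ginv x a a c

theorem inv_mul_metric
    (hginv : ∀ x a b, (∑ c, ginv x a c * g x c b) = if a = b then (1 : ℝ) else 0) (x : Vec N) :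
    Matrix.of (ginv x) * Matrix.of (g x) = 1 := by
  ext a b
  rw [Matrix.mul_apply, Matrix.one_apply]
  exact hginv x a b

theorem metric_mul_inv
    (hginv : ∀ x a b, (∑ c, ginv x a c * g x c b) = if a = b then (1 : ℝ) else 0) (x : Vec N) :
    Matrix.of (g x) * Matrix.of (ginv x) = 1 :=
  mul_eq_one_comm.1 (inv_mul_metric hginv x)

theorem metric_det_ne_zero
    (hginv : ∀ x a b, (∑ c, ginv x a c * g x c b) = if a = b then (1 : ℝ) else 0) (x : Vec N) :
    (Matrix.of (g x)).det ≠ 0 :=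
  fun h => by simpa [h] using congrArg Matrix.det (inv_mul_metric hginv x)

theorem transpose_inv_metric (hgsymm : ∀ x a b, g x a b = g x b a)
    (hginv : ∀ x a b, (∑ c, ginv x a c * g x c b) = if a = b then (1 : ℝ) else 0) (x : Vec N) :
    (Matrix.of (ginv x)).transpose = Matrix.of (ginv x) := by
  have hG : (Matrix.of (g x)).transpose = Matrix.of (g x) := by
    ext a b; exact hgsymm x b a
  have h := congrArg Matrix.transpose (inv_mul_metric hginv x)
  rw [Matrix.transpose_mul, hG, Matrix.transpose_one] at h
  calc _ = (Matrix.of (ginv x) * Matrix.of (g x)) * (Matrix.of (ginv x)).transpose := by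
        rw [inv_mul_metric hginv, one_mul]
    _ = _ := by rw [mul_assoc, h, mul_one]

theorem contDiff_inv_metric (hgsm : ∀ a b, ContDiff ℝ (⊤ : ℕ∞) fun x => g x a b)
    (hginv : ∀ x a b, (∑ c, ginv x a c * g x c b) = if a = b then (1 : ℝ) else 0)
    (a b : Fin N) : ContDiff ℝ (⊤ : ℕ∞) fun x => ginv x a b := by
  have h : ∀ x, (Matrix.of (g x))⁻¹ = Matrix.of (ginv x) := fun x =>
    Matrix.inv_eq_left_inv (inv_mul_metric hginv x)
  have := contDiff_matrix_inv (M := fun x => Matrix.of (g x)) hgsm (metric_det_ne_zero hginv) a b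
  simp only [h] at this
  exact this

theorem contDiff_lower (hgsm : ∀ a b, ContDiff ℝ (⊤ : ℕ∞) fun x => g x a b)
    (hX : ∀ a, ContDiff ℝ (⊤ : ℕ∞) fun x => X x a) (b : Fin N) :
    ContDiff ℝ (⊤ : ℕ∞) (lower g X b) :=
  ContDiff.sum fun a _ => (hgsm a b).mul (hX a)

theorem contDiff_curl (hgsm : ∀ a b, ContDiff ℝ (⊤ : ℕ∞) fun x => g x a b)
    (hX : ∀ a, ContDiff ℝ (⊤ : ℕ∞) fun x => X x a) (a b : Fin N) :
    ContDiff ℝ (⊤ : ℕ∞) fun x => curl g X x a b :=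
  (contDiff_pd (contDiff_lower hgsm hX b) a).sub (contDiff_pd (contDiff_lower hgsm hX a) b)

theorem contDiff_curlUp (hgsm : ∀ a b, ContDiff ℝ (⊤ : ℕ∞) fun x => g x a b)
    (hHsm : ∀ a b, ContDiff ℝ (⊤ : ℕ∞) fun x => ginv x a b)
    (hX : ∀ a, ContDiff ℝ (⊤ : ℕ∞) fun x => X x a) (a b : Fin N) :
    ContDiff ℝ (⊤ : ℕ∞) fun x => curlUp g ginv X x a b := by
  simp only [curlUp, Matrix.mul_apply, Matrix.of_apply]
  exact ContDiff.sum fun c _ => (ContDiff.sum fun d _ =>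
    (hHsm a d).mul (contDiff_curl hgsm hX d c)).mul (hHsm c b)

theorem contDiff_christoffel (hgsm : ∀ a b, ContDiff ℝ (⊤ : ℕ∞) fun x => g x a b)
    (hHsm : ∀ a b, ContDiff ℝ (⊤ : ℕ∞) fun x => ginv x a b) (a b c : Fin N) :
    ContDiff ℝ (⊤ : ℕ∞) fun x => christoffel g ginv x a b c :=
  contDiff_const.mul (ContDiff.sum fun d _ => (hHsm a d).mul
    (((contDiff_pd (hgsm d c) b).add (contDiff_pd (hgsm b d) c)).sub (contDiff_pd (hgsm b c) d)))

theorem contDiff_christoffelTrace (hgsm : ∀ a b, ContDiff ℝ (⊤ : ℕ∞) fun x => g x a b)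
    (hHsm : ∀ a b, ContDiff ℝ (⊤ : ℕ∞) fun x => ginv x a b) (c : Fin N) :
    ContDiff ℝ (⊤ : ℕ∞) (christoffelTrace g ginv c) :=
  ContDiff.sum fun a _ => contDiff_christoffel hgsm hHsm a a c

theorem christoffel_symm (hgsymm : ∀ x a b, g x a b = g x b a) (x : Vec N) (a b c : Fin N) :
    christoffel g ginv x a b c = christoffel g ginv x a c b := by
  have h : ∀ a b, (fun y => g y a b) = fun y => g y b a := fun a b => funext fun y => hgsymm y a b
  simp only [christoffel]
  congr 1
  refine Finset.sum_congr rfl fun d _ => ?_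
  rw [h d c, h b d, h b c]
  ring

theorem curl_antisymm (x : Vec N) (a b : Fin N) : curl g X x a b = - curl g X x b a := by
  simp [curl]

theorem curlUp_antisymm (hgsymm : ∀ x a b, g x a b = g x b a)
    (hginv : ∀ x a b, (∑ c, ginv x a c * g x c b) = if a = b then (1 : ℝ) else 0)
    (x : Vec N) (a b : Fin N) : curlUp g ginv X x a b = - curlUp g ginv X x b a := by
  have hB : (curl g X x).transpose = - curl g X x := by
    ext a b; exact curl_antisymm x b a
  have h : (curlUp g ginv X x).transpose = - curlUp g ginv X x := by
    simp only [curlUp]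
    rw [Matrix.transpose_mul, Matrix.transpose_mul, hB, transpose_inv_metric hgsymm hginv]
    noncomm_ring
  have := congrFun (congrFun h b) a
  simpa using this

theorem matPd_inv_metric (hgsm : ∀ a b, ContDiff ℝ (⊤ : ℕ∞) fun x => g x a b)
    (hginv : ∀ x a b, (∑ c, ginv x a c * g x c b) = if a = b then (1 : ℝ) else 0)
    (x : Vec N) (c : Fin N) :
    matPd (fun y => Matrix.of (ginv y)) c x
      = - (Matrix.of (ginv x) * matPd (fun y => Matrix.of (g y)) c x * Matrix.of (ginv x)) := by
  have h1 := matPd_mul (M := fun y => Matrix.of (ginv y)) (L := fun y => Matrix.of (g y)) (x := x)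
    (fun a b => differentiableAt_of_contDiff (contDiff_inv_metric hgsm hginv a b))
    (fun a b => differentiableAt_of_contDiff (hgsm a b)) c
  have h2 : matPd (fun y => Matrix.of (ginv y) * Matrix.of (g y)) c x = 0 := by
    ext a b
    simp only [inv_mul_metric hginv, matPd, Matrix.of_apply, pd_const, Matrix.zero_apply]
  rw [h2] at h1
  have h3 := congrArg (fun Z => Z * Matrix.of (ginv x)) h1
  simp only [zero_mul, add_mul] at h3
  rw [mul_assoc _ (Matrix.of (g x)), metric_mul_inv hginv, mul_one] at h3
  exact eq_neg_of_add_eq_zero_left h3.symm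

theorem killing_matrix
    (hKill : ∀ x a b, (∑ c, X x c * pd (fun y => g y a b) c x)
        + (∑ c, g x c b * pd (fun y => X y c) a x)
        + (∑ c, g x a c * pd (fun y => X y c) b x) = 0) (x : Vec N) :
    ∑ c, X x c • matPd (fun y => Matrix.of (g y)) c x
      = - ((jac X x).transpose * Matrix.of (g x) + Matrix.of (g x) * jac X x) := by
  ext a b
  simp only [Matrix.sum_apply, Matrix.smul_apply, Matrix.neg_apply, Matrix.add_apply,
    Matrix.mul_apply, Matrix.transpose_apply, jac, matPd, Matrix.of_apply, smul_eq_mul]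
  have := hKill x a b
  simp only [mul_comm (pd _ _ _) (g _ _ _)]
  linarith

/-- The dual one-form of a field commuting with a Killing field has vanishing Lie derivative. -/
theorem lie_lower (hgsm : ∀ a b, ContDiff ℝ (⊤ : ℕ∞) fun x => g x a b)
    (hY : ∀ a, ContDiff ℝ (⊤ : ℕ∞) fun x => Y x a)
    (hKill : ∀ x a b, (∑ c, X x c * pd (fun y => g y a b) c x)
        + (∑ c, g x c b * pd (fun y => X y c) a x)
        + (∑ c, g x a c * pd (fun y => X y c) b x) = 0)
    (hcomm : ∀ x a, (∑ b, (X x b * pd (fun y => Y y a) b x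
        - Y x b * pd (fun y => X y a) b x)) = 0) (a : Fin N) (x : Vec N) :
    ∑ c, X x c * pd (lower g Y a) c x + ∑ c, lower g Y c x * pd (fun y => X y c) a x = 0 := by
  have h1 : ∀ c, pd (lower g Y a) c x = ∑ d, (pd (fun y => g y d a) c x * Y x d
      + g x d a * pd (fun y => Y y d) c x) := fun c => by
    change pd (fun y => ∑ d, g y d a * Y y d) c x = _
    rw [pd_sum _ fun d _ => differentiableAt_of_contDiff ((hgsm d a).mul (hY d))]
    exact Finset.sum_congr rfl fun d _ => pd_mul (differentiableAt_of_contDiff (hgsm d a))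
      (differentiableAt_of_contDiff (hY d)) c
  have hA : ∑ c, X x c * pd (lower g Y a) c x
      = ∑ d, Y x d * ∑ c, X x c * pd (fun y => g y d a) c x
        + ∑ d, g x d a * ∑ c, X x c * pd (fun y => Y y d) c x := by
    simp only [h1, Finset.mul_sum, ← Finset.sum_add_distrib]
    rw [Finset.sum_comm]
    exact Finset.sum_congr rfl fun d _ => Finset.sum_congr rfl fun c _ => by ring
  have hB : ∑ c, lower g Y c x * pd (fun y => X y c) a x
      = ∑ d, Y x d * ∑ c, g x d c * pd (fun y => X y c) a x := by
    simp only [lower, Finset.mul_sum, Finset.sum_mul]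
    rw [Finset.sum_comm]
    exact Finset.sum_congr rfl fun d _ => Finset.sum_congr rfl fun c _ => by ring
  have hC : ∀ d, ∑ c, X x c * pd (fun y => Y y d) c x = ∑ c, Y x c * pd (fun y => X y d) c x :=
    fun d => by
      have := hcomm x d
      rw [Finset.sum_sub_distrib] at this
      linarith
  have hD : ∑ d, g x d a * ∑ c, Y x c * pd (fun y => X y d) c x
      = ∑ d, Y x d * ∑ c, g x c a * pd (fun y => X y c) d x := by
    simp only [Finset.mul_sum]
    rw [Finset.sum_comm]
    exact Finset.sum_congr rfl fun d _ => Finset.sum_congr rfl fun c _ => by ring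
  simp only [hC] at hA
  rw [hA, hB, hD, ← Finset.sum_add_distrib,
    ← Finset.sum_add_distrib]
  refine Finset.sum_eq_zero fun d _ => ?_
  rw [← mul_add, ← mul_add, hKill x d a, mul_zero]

theorem lie_curl (hgsm : ∀ a b, ContDiff ℝ (⊤ : ℕ∞) fun x => g x a b)
    (hX : ∀ a, ContDiff ℝ (⊤ : ℕ∞) fun x => X x a)
    (hY : ∀ a, ContDiff ℝ (⊤ : ℕ∞) fun x => Y x a)
    (hKill : ∀ x a b, (∑ c, X x c * pd (fun y => g y a b) c x)
        + (∑ c, g x c b * pd (fun y => X y c) a x)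
        + (∑ c, g x a c * pd (fun y => X y c) b x) = 0)
    (hcomm : ∀ x a, (∑ b, (X x b * pd (fun y => Y y a) b x
        - Y x b * pd (fun y => X y a) b x)) = 0) (x : Vec N) :
    ∑ c, X x c • matPd (curl g Y) c x
      = - ((jac X x).transpose * curl g Y x + curl g Y x * jac X x) := by
  have hl := contDiff_lower hgsm hY
  have hd : ∀ a b, (∑ c, (pd (fun y => X y c) b x * pd (lower g Y a) c x
      + X x c * pd (pd (lower g Y a) b) c x))
      + ∑ c, (pd (lower g Y c) b x * pd (fun y => X y c) a x
      + lower g Y c x * pd (pd (fun y => X y c) a) b x) = 0 := fun a b => by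
    have h0 : pd (fun y => ∑ c, X y c * pd (lower g Y a) c y
        + ∑ c, lower g Y c y * pd (fun y => X y c) a y) b x = 0 := by
      simp only [lie_lower hgsm hY hKill hcomm, pd_const]
    have s1 : ∀ c, ContDiff ℝ (⊤ : ℕ∞) fun y => X y c * pd (lower g Y a) c y := fun c =>
      (hX c).mul (contDiff_pd (hl a) c)
    have s2 : ∀ c, ContDiff ℝ (⊤ : ℕ∞) fun y => lower g Y c y * pd (fun y => X y c) a y :=
      fun c => (hl c).mul (contDiff_pd (hX c) a)
    rw [pd_add (differentiableAt_of_contDiff (ContDiff.sum fun c _ => s1 c))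
      (differentiableAt_of_contDiff (ContDiff.sum fun c _ => s2 c)),
      pd_sum _ fun c _ => differentiableAt_of_contDiff (s1 c),
      pd_sum _ fun c _ => differentiableAt_of_contDiff (s2 c)] at h0
    rw [← h0]
    congr 1
    · refine Finset.sum_congr rfl fun c _ => ?_
      rw [pd_mul (differentiableAt_of_contDiff (hX c))
        (differentiableAt_of_contDiff (contDiff_pd (hl a) c)), pd_comm (hl a)]
    · refine Finset.sum_congr rfl fun c _ => ?_
      rw [pd_mul (differentiableAt_of_contDiff (hl c))
        (differentiableAt_of_contDiff (contDiff_pd (hX c) a))]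
  ext a b
  simp only [Matrix.sum_apply, Matrix.smul_apply, Matrix.neg_apply, Matrix.add_apply,
    Matrix.mul_apply, Matrix.transpose_apply, jac, matPd, Matrix.of_apply, smul_eq_mul]
  have hc : ∀ c, pd (fun y => curl g Y y a b) c x
      = pd (pd (lower g Y b) a) c x - pd (pd (lower g Y a) b) c x := fun c =>
    pd_sub (differentiableAt_of_contDiff (contDiff_pd (hl b) a))
      (differentiableAt_of_contDiff (contDiff_pd (hl a) b)) c
  rw [eq_neg_iff_add_eq_zero, ← Finset.sum_add_distrib, ← Finset.sum_add_distrib]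
  have e1 := hd a b
  have e2 := hd b a
  rw [← Finset.sum_add_distrib] at e1 e2
  refine Eq.trans ?_ (sub_eq_zero.2 (e2.trans e1.symm))
  rw [← Finset.sum_sub_distrib]
  refine Finset.sum_congr rfl fun c _ => ?_
  rw [hc, pd_comm (hX c) b a]
  simp only [curl, Matrix.of_apply]
  ring

/-- The raised curl of a field commuting with a Killing field is invariant. -/
theorem lie_curlUp (hgsm : ∀ a b, ContDiff ℝ (⊤ : ℕ∞) fun x => g x a b)
    (hX : ∀ a, ContDiff ℝ (⊤ : ℕ∞) fun x => X x a)
    (hY : ∀ a, ContDiff ℝ (⊤ : ℕ∞) fun x => Y x a)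
    (hginv : ∀ x a b, (∑ c, ginv x a c * g x c b) = if a = b then (1 : ℝ) else 0)
    (hKill : ∀ x a b, (∑ c, X x c * pd (fun y => g y a b) c x)
        + (∑ c, g x c b * pd (fun y => X y c) a x)
        + (∑ c, g x a c * pd (fun y => X y c) b x) = 0)
    (hcomm : ∀ x a, (∑ b, (X x b * pd (fun y => Y y a) b x
        - Y x b * pd (fun y => X y a) b x)) = 0) (x : Vec N) :
    ∑ c, X x c • matPd (curlUp g ginv Y) c x
      = jac X x * curlUp g ginv Y x + curlUp g ginv Y x * (jac X x).transpose := by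
  have hH := contDiff_inv_metric hgsm hginv
  have hB := contDiff_curl hgsm hY
  have hHB : ∀ a b, ContDiff ℝ (⊤ : ℕ∞) fun x => (Matrix.of (ginv x) * curl g Y x) a b :=
    fun a b => by
    simp only [Matrix.mul_apply]
    exact ContDiff.sum fun c _ => (hH a c).mul (hB c b)
  have h1 : ∀ c, matPd (curlUp g ginv Y) c x
      = 1 * matPd (fun y => Matrix.of (ginv y)) c x * (curl g Y x * Matrix.of (ginv x))
        + Matrix.of (ginv x) * matPd (curl g Y) c x * Matrix.of (ginv x)
        + Matrix.of (ginv x) * curl g Y x * matPd (fun y => Matrix.of (ginv y)) c x * 1 :=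
      fun c => by
    have e1 := matPd_mul (M := fun y => Matrix.of (ginv y)) (L := curl g Y) (x := x)
      (fun a b => differentiableAt_of_contDiff (hH a b))
      (fun a b => differentiableAt_of_contDiff (hB a b)) c
    have e2 := matPd_mul (M := fun y => Matrix.of (ginv y) * curl g Y y)
      (L := fun y => Matrix.of (ginv y)) (x := x)
      (fun a b => differentiableAt_of_contDiff (hHB a b))
      (fun a b => differentiableAt_of_contDiff (hH a b)) c
    rw [e1] at e2
    refine Eq.trans e2 ?_
    noncomm_ring
  have hsum : ∀ (L R : Matrix (Fin N) (Fin N) ℝ) (M : Fin N → Matrix (Fin N) (Fin N) ℝ),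
      ∑ c, X x c • (L * M c * R) = L * (∑ c, X x c • M c) * R := fun L R M => by
    simp only [Matrix.mul_sum, Matrix.sum_mul, Matrix.mul_smul, Matrix.smul_mul]
  have h2 : ∑ c, X x c • matPd (fun y => Matrix.of (ginv y)) c x
      = Matrix.of (ginv x) * (jac X x).transpose + jac X x * Matrix.of (ginv x) := by
    simp only [matPd_inv_metric hgsm hginv, smul_neg, Finset.sum_neg_distrib, hsum]
    rw [killing_matrix hKill]
    have hHG := inv_mul_metric hginv x
    have hGH := metric_mul_inv hginv x
    generalize Matrix.of (ginv x) = H at *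
    generalize Matrix.of (g x) = G at *
    calc _ = H * (jac X x).transpose * (G * H) + (H * G) * jac X x * H := by noncomm_ring
      _ = _ := by rw [hHG, hGH, mul_one, one_mul]
  simp only [h1, smul_add, Finset.sum_add_distrib, hsum]
  rw [h2, lie_curl hgsm hX hY hKill hcomm]
  simp only [curlUp]
  noncomm_ring

theorem christoffelTrace_eq (hgsymm : ∀ x a b, g x a b = g x b a)
    (hginv : ∀ x a b, (∑ c, ginv x a c * g x c b) = if a = b then (1 : ℝ) else 0)
    (c : Fin N) (x : Vec N) :
    christoffelTrace g ginv c x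
      = (1 / 2) * (Matrix.of (ginv x) * matPd (fun y => Matrix.of (g y)) c x).trace := by
  have hs : ∀ a b, (fun y => g y a b) = fun y => g y b a := fun a b => funext fun y => hgsymm y a b
  have hHs : ∀ a b, ginv x a b = ginv x b a := fun a b =>
    congrFun (congrFun (transpose_inv_metric hgsymm hginv x) b) a
  simp only [christoffelTrace, christoffel, ← Finset.mul_sum, Matrix.trace, Matrix.diag_apply,
    Matrix.mul_apply, matPd, Matrix.of_apply, mul_sub, mul_add, Finset.sum_add_distrib,
    Finset.sum_sub_distrib]
  have h1 : ∑ a, ∑ d, ginv x a d * pd (fun y => g y d c) a x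
      = ∑ a, ∑ d, ginv x a d * pd (fun y => g y a c) d x := by
    rw [Finset.sum_comm]
    exact Finset.sum_congr rfl fun a _ => Finset.sum_congr rfl fun d _ => by rw [hHs]
  rw [h1]
  simp only [hs]
  ring_nf

/-- Killing fields are divergence free. -/
theorem killing_div (hgsymm : ∀ x a b, g x a b = g x b a)
    (hginv : ∀ x a b, (∑ c, ginv x a c * g x c b) = if a = b then (1 : ℝ) else 0)
    (hKill : ∀ x a b, (∑ c, X x c * pd (fun y => g y a b) c x)
        + (∑ c, g x c b * pd (fun y => X y c) a x)
        + (∑ c, g x a c * pd (fun y => X y c) b x) = 0) (x : Vec N) :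
    ∑ c, X x c * christoffelTrace g ginv c x = - (jac X x).trace := by
  have h := congrArg (fun Z => (Matrix.of (ginv x) * Z).trace) (killing_matrix hKill x)
  simp only [Matrix.mul_sum, Matrix.trace_sum, Matrix.mul_smul, Matrix.trace_smul, mul_neg,
    mul_add, Matrix.trace_neg, Matrix.trace_add, smul_eq_mul] at h
  rw [← mul_assoc, Matrix.trace_mul_comm, ← mul_assoc, metric_mul_inv hginv, one_mul,
    ← mul_assoc, inv_mul_metric hginv, one_mul, Matrix.trace_transpose] at h
  simp only [christoffelTrace_eq hgsymm hginv]
  have h2 : ∑ c, X x c * (1 / 2 * (Matrix.of (ginv x)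
      * matPd (fun y => Matrix.of (g y)) c x).trace)
      = 1 / 2 * ∑ c, X x c * (Matrix.of (ginv x)
      * matPd (fun y => Matrix.of (g y)) c x).trace := by
    rw [Finset.mul_sum]
    exact Finset.sum_congr rfl fun c _ => by ring
  rw [h2, h]
  ring

/-- The covariant derivative `∇_b X^a` of a vector field. -/
def covDeriv (g ginv : Vec N → Fin N → Fin N → ℝ) (X : Vec N → Vec N) (x : Vec N) :
    Matrix (Fin N) (Fin N) ℝ :=
  Matrix.of fun a b => pd (fun y => X y a) b x + ∑ d, christoffel g ginv x a b d * X x d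

theorem metric_mul_christoffel
    (hginv : ∀ x a b, (∑ c, ginv x a c * g x c b) = if a = b then (1 : ℝ) else 0)
    (x : Vec N) (a b d : Fin N) :
    ∑ e, g x a e * christoffel g ginv x e b d = (1 / 2) * (pd (fun y => g y a d) b x
      + pd (fun y => g y b a) d x - pd (fun y => g y b d) a x) := by
  set L : Fin N → ℝ := fun e => pd (fun y => g y e d) b x
      + pd (fun y => g y b e) d x - pd (fun y => g y b d) e x with hL
  have h : (Matrix.of (g x)).mulVec ((Matrix.of (ginv x)).mulVec L) = L := by
    rw [Matrix.mulVec_mulVec, metric_mul_inv hginv, Matrix.one_mulVec]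
  have h2 := congrFun h a
  simp only [Matrix.mulVec, dotProduct, Matrix.of_apply] at h2
  change _ = 1 / 2 * L a
  rw [← h2, Finset.mul_sum]
  refine Finset.sum_congr rfl fun e _ => ?_
  simp only [christoffel, hL]
  ring

/-- Metric compatibility of the Levi-Civita connection, for the inverse metric. -/
theorem pd_inv_metric (hgsm : ∀ a b, ContDiff ℝ (⊤ : ℕ∞) fun x => g x a b)
    (hgsymm : ∀ x a b, g x a b = g x b a)
    (hginv : ∀ x a b, (∑ c, ginv x a c * g x c b) = if a = b then (1 : ℝ) else 0)
    (x : Vec N) (a b c : Fin N) :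
    pd (fun y => ginv y b c) a x = - ((∑ d, christoffel g ginv x b a d * ginv x d c)
      + ∑ d, christoffel g ginv x c a d * ginv x d b) := by
  have hs : ∀ a b, (fun y => g y a b) = fun y => g y b a := fun a b => funext fun y => hgsymm y a b
  set Γ : Matrix (Fin N) (Fin N) ℝ := Matrix.of fun b d => christoffel g ginv x b a d with hΓ
  have hGΓ : Matrix.of (g x) * Γ + (Matrix.of (g x) * Γ).transpose
      = matPd (fun y => Matrix.of (g y)) a x := by
    ext b d
    simp only [Matrix.add_apply, Matrix.transpose_apply, Matrix.mul_apply, hΓ, Matrix.of_apply,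
      metric_mul_christoffel hginv, matPd]
    rw [hs d b, hs a b]
    ring
  have hGt : (Matrix.of (g x)).transpose = Matrix.of (g x) := by
    ext a b; exact hgsymm x b a
  have hHt := transpose_inv_metric hgsymm hginv x
  have key : matPd (fun y => Matrix.of (ginv y)) a x
      = - (Γ * Matrix.of (ginv x) + (Γ * Matrix.of (ginv x)).transpose) := by
    rw [matPd_inv_metric hgsm hginv, ← hGΓ]
    have hHG := inv_mul_metric hginv x
    have hGH := metric_mul_inv hginv x
    rw [Matrix.transpose_mul, Matrix.transpose_mul, hHt, hGt]
    generalize Matrix.of (ginv x) = H at *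
    generalize Matrix.of (g x) = G at *
    calc _ = -((H * G) * Γ * H + H * Γ.transpose * (G * H)) := by noncomm_ring
      _ = _ := by rw [hHG, hGH, mul_one, one_mul]
  have := congrFun (congrFun key b) c
  simpa only [matPd, Matrix.of_apply, Matrix.neg_apply, Matrix.add_apply, Matrix.transpose_apply,
    Matrix.mul_apply, hΓ] using this

/-- For a Killing field, the raised curl is a multiple of the covariant derivative. -/
theorem curlUp_eq_covDeriv (hgsm : ∀ a b, ContDiff ℝ (⊤ : ℕ∞) fun x => g x a b)
    (hX : ∀ a, ContDiff ℝ (⊤ : ℕ∞) fun x => X x a)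
    (hgsymm : ∀ x a b, g x a b = g x b a)
    (hginv : ∀ x a b, (∑ c, ginv x a c * g x c b) = if a = b then (1 : ℝ) else 0)
    (hKill : ∀ x a b, (∑ c, X x c * pd (fun y => g y a b) c x)
        + (∑ c, g x c b * pd (fun y => X y c) a x)
        + (∑ c, g x a c * pd (fun y => X y c) b x) = 0) (x : Vec N) :
    curlUp g ginv X x = (-2 : ℝ) • (covDeriv g ginv X x * Matrix.of (ginv x)) := by
  have hs : ∀ a b, (fun y => g y a b) = fun y => g y b a := fun a b => funext fun y => hgsymm y a b
  have hl : ∀ a b, pd (lower g X a) b x = ∑ e, (pd (fun y => g y e a) b x * X x e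
      + g x e a * pd (fun y => X y e) b x) := fun a b => by
    change pd (fun y => ∑ d, g y d a * X y d) b x = _
    rw [pd_sum _ fun d _ => differentiableAt_of_contDiff ((hgsm d a).mul (hX d))]
    exact Finset.sum_congr rfl fun d _ => pd_mul (differentiableAt_of_contDiff (hgsm d a))
      (differentiableAt_of_contDiff (hX d)) b
  have hB : curl g X x = (-2 : ℝ) • (Matrix.of (g x) * covDeriv g ginv X x) := by
    ext a b
    have h1 : ∑ e, g x a e * ∑ d, christoffel g ginv x e b d * X x d
        = ∑ d, (1 / 2) * (pd (fun y => g y a d) b x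
      + pd (fun y => g y b a) d x - pd (fun y => g y b d) a x) * X x d := by
      simp only [Finset.mul_sum, ← metric_mul_christoffel hginv, Finset.sum_mul]
      rw [Finset.sum_comm]
      exact Finset.sum_congr rfl fun d _ => Finset.sum_congr rfl fun c _ => by ring
    simp only [curl, Matrix.of_apply, Matrix.smul_apply, smul_eq_mul, Matrix.mul_apply, covDeriv,
      mul_add (g x _ _), Finset.sum_add_distrib, h1, hl]
    have hK := hKill x b a
    simp only [← Finset.sum_add_distrib] at hK ⊢
    rw [← sub_eq_zero, Finset.mul_sum, ← Finset.sum_sub_distrib, ← Finset.sum_sub_distrib, ← hK]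
    refine Finset.sum_congr rfl fun e _ => ?_
    rw [hs e b, hs e a, hgsymm x e a, hgsymm x b e]
    ring
  rw [curlUp, hB, Matrix.mul_smul, Matrix.smul_mul, ← mul_assoc, inv_mul_metric hginv, one_mul]

theorem sum_rotate {ι κ : Type*} [Fintype ι] [Fintype κ] (f : ι → ι → κ → ℝ) :
    ∑ a, ∑ b, ∑ c, f a b c = ∑ c, ∑ a, ∑ b, f a b c :=
  (Finset.sum_congr rfl fun _ _ => Finset.sum_comm).trans Finset.sum_comm

/-- The contracted Ricci identity for a Killing field. -/
theorem div_covDeriv (hgsm : ∀ a b, ContDiff ℝ (⊤ : ℕ∞) fun x => g x a b)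
    (hX : ∀ a, ContDiff ℝ (⊤ : ℕ∞) fun x => X x a)
    (hgsymm : ∀ x a b, g x a b = g x b a)
    (hginv : ∀ x a b, (∑ c, ginv x a c * g x c b) = if a = b then (1 : ℝ) else 0)
    (hKill : ∀ x a b, (∑ c, X x c * pd (fun y => g y a b) c x)
        + (∑ c, g x c b * pd (fun y => X y c) a x)
        + (∑ c, g x a c * pd (fun y => X y c) b x) = 0) (x : Vec N) (b : Fin N) :
    ∑ a, (pd (fun y => covDeriv g ginv X y a b) a x
        + christoffelTrace g ginv a x * covDeriv g ginv X x a b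
        - ∑ d, christoffel g ginv x d a b * covDeriv g ginv X x a d)
      = ∑ d, ricci g ginv x b d * X x d := by
  have hHsm := contDiff_inv_metric hgsm hginv
  have hΓ := contDiff_christoffel hgsm hHsm
  have hΓt := contDiff_christoffelTrace hgsm hHsm
  have h1 : ∀ a, pd (fun y => covDeriv g ginv X y a b) a x
      = pd (pd (fun y => X y a) a) b x + ∑ d, (pd (fun y => christoffel g ginv y a b d) a x * X x d
        + christoffel g ginv x a b d * pd (fun y => X y d) a x) := fun a => by
    simp only [covDeriv, Matrix.of_apply]
    rw [pd_add (differentiableAt_of_contDiff (contDiff_pd (hX a) b))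
      (differentiableAt_of_contDiff (ContDiff.sum fun d _ => (hΓ a b d).mul (hX d))),
      pd_sum _ fun d _ => differentiableAt_of_contDiff ((hΓ a b d).mul (hX d)), pd_comm (hX a)]
    congr 1
    exact Finset.sum_congr rfl fun d _ => pd_mul (differentiableAt_of_contDiff (hΓ a b d))
      (differentiableAt_of_contDiff (hX d)) a
  have h2 : ∑ a, pd (pd (fun y => X y a) a) b x + ∑ d, (pd (christoffelTrace g ginv d) b x * X x d
        + christoffelTrace g ginv d x * pd (fun y => X y d) b x) = 0 := by
    have h0 : pd (fun y => ∑ a, pd (fun y => X y a) a y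
        + ∑ d, christoffelTrace g ginv d y * X y d) b x = 0 := by
      have : ∀ y, ∑ a, pd (fun y => X y a) a y + ∑ d, christoffelTrace g ginv d y * X y d = 0 :=
        fun y => by
          have := killing_div hgsymm hginv hKill y
          simp only [jac, Matrix.trace, Matrix.diag_apply, Matrix.of_apply, mul_comm (X y _)]
            at this
          linarith
      simp only [this, pd_const]
    have s2 : ∀ d, ContDiff ℝ (⊤ : ℕ∞) fun y => christoffelTrace g ginv d y * X y d :=
      fun d => (hΓt d).mul (hX d)
    rw [pd_add (differentiableAt_of_contDiff (ContDiff.sum fun c _ => contDiff_pd (hX c) c))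
      (differentiableAt_of_contDiff (ContDiff.sum fun c _ => s2 c)),
      pd_sum _ fun c _ => differentiableAt_of_contDiff (contDiff_pd (hX c) c),
      pd_sum _ fun c _ => differentiableAt_of_contDiff (s2 c)] at h0
    rw [← h0]
    congr 1
    exact Finset.sum_congr rfl fun c _ => (pd_mul (differentiableAt_of_contDiff (hΓt c))
        (differentiableAt_of_contDiff (hX c)) b).symm
  have h3 : ∀ d, pd (christoffelTrace g ginv d) b x
      = ∑ a, pd (fun y => christoffel g ginv y a a d) b x := fun d =>
    pd_sum _ (fun a _ => differentiableAt_of_contDiff (hΓ a a d)) b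
  have q1 : ∑ a, christoffelTrace g ginv a x * ∑ d, christoffel g ginv x a b d * X x d
      = ∑ d, (∑ a, ∑ e, christoffel g ginv x a a e * christoffel g ginv x e b d) * X x d := by
    simp only [christoffelTrace, Finset.sum_mul]
    conv_rhs => rw [sum_rotate]
    refine Finset.sum_congr rfl fun e _ => ?_
    rw [Finset.sum_comm]
    exact Finset.sum_congr rfl fun a _ => by
      rw [Finset.mul_sum]
      exact Finset.sum_congr rfl fun d _ => by ring
  have q2 : ∑ a, ∑ d, christoffel g ginv x d a b * ∑ c, christoffel g ginv x a d c * X x c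
      = ∑ d, (∑ a, ∑ e, christoffel g ginv x a b e * christoffel g ginv x e a d) * X x d := by
    simp only [Finset.sum_mul, Finset.mul_sum]
    rw [sum_rotate]
    refine Finset.sum_congr rfl fun d _ => ?_
    rw [Finset.sum_comm]
    exact Finset.sum_congr rfl fun a _ => Finset.sum_congr rfl fun e _ => by
      rw [christoffel_symm hgsymm x a e b]; ring
  have q3 : ∑ a, ∑ d, christoffel g ginv x a b d * pd (fun y => X y d) a x
      = ∑ a, ∑ d, christoffel g ginv x d a b * pd (fun y => X y a) d x := by
    rw [Finset.sum_comm]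
    exact Finset.sum_congr rfl fun d _ => Finset.sum_congr rfl fun c _ => by
      rw [christoffel_symm hgsymm]
  have q4 : ∑ a, ∑ d, pd (fun y => christoffel g ginv y a b d) a x * X x d
      = ∑ d, (∑ a, pd (fun y => christoffel g ginv y a b d) a x) * X x d := by
    simp only [Finset.sum_mul]
    exact Finset.sum_comm
  simp only [h3] at h2
  simp only [ricci, add_mul, sub_mul, Finset.sum_add_distrib, Finset.sum_sub_distrib, h1] at h2 ⊢
  simp only [covDeriv, Matrix.of_apply, mul_add, Finset.sum_add_distrib]
  rw [q1, q2, q3, q4]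
  linarith

/-- In an Einstein space, the raised curl of a Killing field has divergence proportional to the
field. -/
theorem div_curlUp {lam : ℝ} (hgsm : ∀ a b, ContDiff ℝ (⊤ : ℕ∞) fun x => g x a b)
    (hX : ∀ a, ContDiff ℝ (⊤ : ℕ∞) fun x => X x a)
    (hgsymm : ∀ x a b, g x a b = g x b a)
    (hginv : ∀ x a b, (∑ c, ginv x a c * g x c b) = if a = b then (1 : ℝ) else 0)
    (hKill : ∀ x a b, (∑ c, X x c * pd (fun y => g y a b) c x)
        + (∑ c, g x c b * pd (fun y => X y c) a x)
        + (∑ c, g x a c * pd (fun y => X y c) b x) = 0)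
    (hEinstein : ∀ x b c, ricci g ginv x b c = lam * g x b c) (x : Vec N) (c : Fin N) :
    ∑ a, (pd (fun y => curlUp g ginv X y a c) a x
      + christoffelTrace g ginv a x * curlUp g ginv X x a c) = -2 * lam * X x c := by
  have hHsm := contDiff_inv_metric hgsm hginv
  have hΓ := contDiff_christoffel hgsm hHsm
  have hHs : ∀ a b, ginv x a b = ginv x b a := fun a b =>
    congrFun (congrFun (transpose_inv_metric hgsymm hginv x) b) a
  have hA : ∀ a b, ContDiff ℝ (⊤ : ℕ∞) fun y => covDeriv g ginv X y a b := fun a b =>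
    (contDiff_pd (hX a) b).add (ContDiff.sum fun d _ => (hΓ a b d).mul (hX d))
  have hF : ∀ y a c, curlUp g ginv X y a c = -2 * ∑ b, covDeriv g ginv X y a b * ginv y b c :=
    fun y a c => by
      rw [curlUp_eq_covDeriv hgsm hX hgsymm hginv hKill, Matrix.smul_apply, smul_eq_mul,
        Matrix.mul_apply]
      rfl
  have h1 : ∀ a, pd (fun y => curlUp g ginv X y a c) a x
      = -2 * ∑ b, (pd (fun y => covDeriv g ginv X y a b) a x * ginv x b c
        + covDeriv g ginv X x a b * pd (fun y => ginv y b c) a x) := fun a => by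
    simp only [hF]
    rw [pd_const_mul _ (differentiableAt_of_contDiff (ContDiff.sum fun b _ =>
      (hA a b).mul (hHsm b c))),
      pd_sum _ fun b _ => differentiableAt_of_contDiff ((hA a b).mul (hHsm b c))]
    congr 1
    exact Finset.sum_congr rfl fun b _ => pd_mul (differentiableAt_of_contDiff (hA a b))
      (differentiableAt_of_contDiff (hHsm b c)) a
  have hz : ∑ a, ∑ b, covDeriv g ginv X x a b * ∑ d, christoffel g ginv x c a d * ginv x d b
      = 0 := by
    have e : ∑ a, ∑ b, covDeriv g ginv X x a b * ∑ d, christoffel g ginv x c a d * ginv x d b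
      = ∑ a, ∑ d, (-1 / 2) * (christoffel g ginv x c a d * curlUp g ginv X x a d) := by
      simp only [hF, Finset.mul_sum]
      refine Finset.sum_congr rfl fun a _ => ?_
      rw [Finset.sum_comm]
      exact Finset.sum_congr rfl fun d _ => Finset.sum_congr rfl fun b _ => by
        rw [hHs d b]; ring
    have e2 : ∑ a, ∑ d, christoffel g ginv x c a d * curlUp g ginv X x a d
        = - ∑ a, ∑ d, christoffel g ginv x c a d * curlUp g ginv X x a d := by
      conv_lhs => rw [Finset.sum_comm]
      simp only [← Finset.sum_neg_distrib]
      exact Finset.sum_congr rfl fun a _ => Finset.sum_congr rfl fun d _ => by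
        rw [christoffel_symm hgsymm, curlUp_antisymm hgsymm hginv]; ring
    rw [e]
    simp only [← Finset.mul_sum]
    linarith
  have hy : ∑ a, ∑ b, covDeriv g ginv X x a b * ∑ d, christoffel g ginv x b a d * ginv x d c
      = ∑ b, (∑ a, ∑ d, christoffel g ginv x d a b * covDeriv g ginv X x a d) * ginv x b c := by
    simp only [Finset.sum_mul, Finset.mul_sum]
    rw [sum_rotate]
    exact Finset.sum_congr rfl fun b _ => Finset.sum_congr rfl fun a _ =>
      Finset.sum_congr rfl fun d _ => by ring
  have hR : ∑ b, (∑ d, ricci g ginv x b d * X x d) * ginv x b c = lam * X x c := by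
    have hX1 : ∑ d, (∑ b, ginv x c b * g x b d) * X x d = X x c := by simp [hginv]
    simp only [hEinstein, ← hX1, Finset.sum_mul, Finset.mul_sum]
    rw [Finset.sum_comm]
    exact Finset.sum_congr rfl fun d _ => Finset.sum_congr rfl fun b _ => by
      rw [hHs b c]; ring
  simp only [← div_covDeriv hgsm hX hgsymm hginv hKill] at hR
  simp only [h1]
  simp only [hF, pd_inv_metric hgsm hgsymm hginv]
  have hL : ∀ a, -2 * ∑ b, (pd (fun y => covDeriv g ginv X y a b) a x * ginv x b c
        + covDeriv g ginv X x a b * -((∑ d, christoffel g ginv x b a d * ginv x d c)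
          + ∑ d, christoffel g ginv x c a d * ginv x d b))
      + christoffelTrace g ginv a x * (-2 * ∑ b, covDeriv g ginv X x a b * ginv x b c)
      = -2 * (∑ b, (pd (fun y => covDeriv g ginv X y a b) a x
            + christoffelTrace g ginv a x * covDeriv g ginv X x a b) * ginv x b c
          - ∑ b, covDeriv g ginv X x a b * ∑ d, christoffel g ginv x b a d * ginv x d c
          - ∑ b, covDeriv g ginv X x a b * ∑ d, christoffel g ginv x c a d * ginv x d b) := by
    intro a
    simp only [← Finset.sum_sub_distrib]
    rw [mul_left_comm, ← mul_add, Finset.mul_sum, ← Finset.sum_add_distrib]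
    congr 1
    exact Finset.sum_congr rfl fun b _ => by ring
  rw [Finset.sum_congr rfl fun a _ => hL a, ← Finset.mul_sum, mul_assoc (-2) lam, ← hR]
  simp only [Finset.sum_sub_distrib, sub_mul, hz, hy, sub_zero]
  rw [Finset.sum_comm]
  simp only [Finset.sum_mul]

end metric

/-! ### The twist as a wedge product -/

theorem sign_permCongr_sumCongr_one {k m : ℕ} (τ : Equiv.Perm (Fin m)) :
    Equiv.Perm.sign (finSumFinEquiv.permCongr
      (Equiv.Perm.sumCongr (1 : Equiv.Perm (Fin k)) τ)) = Equiv.Perm.sign τ := by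
  rw [Equiv.Perm.sign_permCongr, Equiv.Perm.sign_sumCongr, Equiv.Perm.sign_one, one_mul]

/-- Antisymmetrizing a two-tensor against a determinant yields a sum of determinants. -/
theorem sum_perm_mul_det {m : ℕ} (B : Matrix (Fin (2 + m)) (Fin (2 + m)) ℝ)
    (L : Fin m → Vec (2 + m)) (V : Fin (2 + m) → Vec (2 + m)) :
    ∑ σ : Equiv.Perm (Fin (2 + m)), ((Equiv.Perm.sign σ : ℤ) : ℝ)
        * (∑ a, ∑ b, B a b * V (σ (Fin.castAdd m 0)) a * V (σ (Fin.castAdd m 1)) b)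
        * Matrix.det (Matrix.of fun i j : Fin m => L i ⬝ᵥ V (σ (Fin.natAdd 2 j)))
      = m.factorial * ((Matrix.of V).det * bivDet B L) := by
  have hD : ∀ a b : Fin (2 + m), Matrix.detRowAlternating
      (Fin.append ![(Pi.single a 1 : Vec (2 + m)), Pi.single b 1] L) * (Matrix.of V).det
      = ∑ σ : Equiv.Perm (Fin (2 + m)), ((Equiv.Perm.sign σ : ℤ) : ℝ)
        * (V (σ (Fin.castAdd m 0)) a * V (σ (Fin.castAdd m 1)) b
          * ∏ i, L i ⬝ᵥ V (σ (Fin.natAdd 2 i))) := fun a b => by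
    have h0 : Matrix.detRowAlternating
      (Fin.append ![(Pi.single a 1 : Vec (2 + m)), Pi.single b 1] L) * (Matrix.of V).det
      = Matrix.det (Matrix.of V * (Matrix.of
        (Fin.append ![(Pi.single a 1 : Vec (2 + m)), Pi.single b 1] L)).transpose) := by
      rw [Matrix.det_mul, Matrix.det_transpose, mul_comm]
      rfl
    rw [h0, Matrix.det_apply']
    refine Finset.sum_congr rfl fun σ _ => ?_
    congr 1
    rw [Fin.prod_univ_add, Fin.prod_univ_two]
    have he : ∀ i j, (Matrix.of V * (Matrix.of
        (Fin.append ![(Pi.single a 1 : Vec (2 + m)), Pi.single b 1] L)).transpose) j i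
        = Fin.append ![(Pi.single a 1 : Vec (2 + m)), Pi.single b 1] L i ⬝ᵥ V j :=
      fun i j => dotProduct_comm _ _
    simp only [he, Fin.append_left, Fin.append_right, Matrix.cons_val_zero, Matrix.cons_val_one,
      single_one_dotProduct]
  have hτ : ∀ τ : Equiv.Perm (Fin m), ∑ σ : Equiv.Perm (Fin (2 + m)),
      ((Equiv.Perm.sign σ : ℤ) : ℝ)
        * (∑ a, ∑ b, B a b * V (σ (Fin.castAdd m 0)) a * V (σ (Fin.castAdd m 1)) b)
        * (((Equiv.Perm.sign τ : ℤ) : ℝ) * ∏ i, L i ⬝ᵥ V (σ (Fin.natAdd 2 (τ i))))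
      = (Matrix.of V).det * bivDet B L := fun τ => by
    have h1 : (Matrix.of V).det * bivDet B L = ∑ σ : Equiv.Perm (Fin (2 + m)),
      ((Equiv.Perm.sign σ : ℤ) : ℝ)
        * (∑ a, ∑ b, B a b * V (σ (Fin.castAdd m 0)) a * V (σ (Fin.castAdd m 1)) b)
        * ∏ i, L i ⬝ᵥ V (σ (Fin.natAdd 2 i)) := by
      simp only [bivDet, Finset.mul_sum, Finset.sum_mul]
      conv_rhs => rw [Finset.sum_comm]
      refine Finset.sum_congr rfl fun a _ => ?_
      conv_rhs => rw [Finset.sum_comm]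
      refine Finset.sum_congr rfl fun b _ => ?_
      rw [mul_comm, mul_assoc, hD, Finset.mul_sum]
      exact Finset.sum_congr rfl fun σ _ => by ring
    rw [h1]
    conv_rhs => rw [← Equiv.sum_comp (Equiv.mulRight (finSumFinEquiv.permCongr
      (Equiv.Perm.sumCongr (1 : Equiv.Perm (Fin 2)) τ)))]
    refine Finset.sum_congr rfl fun σ _ => ?_
    have e1 : ∀ i : Fin 2, (finSumFinEquiv.permCongr
      (Equiv.Perm.sumCongr (1 : Equiv.Perm (Fin 2)) τ)) (Fin.castAdd m i) = Fin.castAdd m i := by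
      intro i; simp [Equiv.permCongr_apply]
    have e2 : ∀ i : Fin m, (finSumFinEquiv.permCongr
      (Equiv.Perm.sumCongr (1 : Equiv.Perm (Fin 2)) τ)) (Fin.natAdd 2 i)
        = Fin.natAdd 2 (τ i) := by
      intro i; simp [Equiv.permCongr_apply]
    simp only [Equiv.coe_mulRight, Equiv.Perm.mul_apply, e1, e2, Equiv.Perm.sign_mul,
      sign_permCongr_sumCongr_one]
    push_cast
    ring
  have hdet : ∀ σ : Equiv.Perm (Fin (2 + m)),
      Matrix.det (Matrix.of fun i j : Fin m => L i ⬝ᵥ V (σ (Fin.natAdd 2 j)))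
      = ∑ τ : Equiv.Perm (Fin m), ((Equiv.Perm.sign τ : ℤ) : ℝ)
        * ∏ i, L i ⬝ᵥ V (σ (Fin.natAdd 2 (τ i))) := fun σ => by
    rw [← Matrix.det_transpose, Matrix.det_apply']
    rfl
  simp only [hdet, Finset.mul_sum (s := (univ : Finset (Equiv.Perm (Fin m))))]
  rw [Finset.sum_comm, Finset.sum_congr rfl fun τ _ => hτ τ]
  simp [Finset.card_univ, Fintype.card_perm]

/-- Change of basis in `bivDet`. -/
theorem bivDet_mul_transpose {m : ℕ} (A F : Matrix (Fin (2 + m)) (Fin (2 + m)) ℝ)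
    (v : Fin m → Vec (2 + m)) :
    bivDet (A * F * A.transpose) (fun i => A.mulVec (v i)) = A.det * bivDet F v := by
  have h : ∀ a b, Matrix.detRowAlternating (Fin.append
      ![A.mulVec (Pi.single a 1), A.mulVec (Pi.single b 1)] fun i => A.mulVec (v i))
      = A.det * Matrix.detRowAlternating
        (Fin.append ![(Pi.single a 1 : Vec (2 + m)), Pi.single b 1] v) := fun a b => by
    have h0 : Fin.append ![A.mulVec (Pi.single a 1), A.mulVec (Pi.single b 1)]
        (fun i => A.mulVec (v i)) = Matrix.of (Fin.append
        ![(Pi.single a 1 : Vec (2 + m)), Pi.single b 1] v) * A.transpose := by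
      ext i j
      rw [Matrix.mul_apply]
      refine Fin.addCases (fun i => ?_) (fun i => ?_) i
      · fin_cases i <;> simp [Pi.single_apply]
      · simp [Matrix.mulVec, dotProduct, mul_comm]
    rw [h0]
    change Matrix.det _ = _ * Matrix.det _
    rw [Matrix.det_mul, Matrix.det_transpose, mul_comm]
    rfl
  have hF : A * F * A.transpose = ∑ a, ∑ b, F a b •
      Matrix.vecMulVec (A.mulVec (Pi.single a 1)) (A.mulVec (Pi.single b 1)) := by
    ext i j
    simp only [Matrix.mul_apply, Matrix.sum_apply, Matrix.smul_apply, Matrix.vecMulVec_apply,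
      Matrix.mulVec_single_one, Matrix.transpose_apply, Matrix.col_apply, smul_eq_mul,
      Finset.sum_mul]
    rw [Finset.sum_comm]
    exact Finset.sum_congr rfl fun a _ => Finset.sum_congr rfl fun b _ => by ring
  rw [hF]
  simp only [bivDet_sum, bivDet_smul, bivDet_vecMulVec, h]
  rw [bivDet, Finset.mul_sum]
  refine Finset.sum_congr rfl fun a _ => ?_
  rw [Finset.mul_sum]
  exact Finset.sum_congr rfl fun b _ => by ring

/-- The exterior derivative of the one-form dual to a vector field. -/
theorem extd_one_form {N : ℕ} {g : Vec N → Fin N → Fin N → ℝ} {X : Vec N → Vec N}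
    (hgsm : ∀ a b, ContDiff ℝ (⊤ : ℕ∞) fun x => g x a b)
    (hX : ∀ a, ContDiff ℝ (⊤ : ℕ∞) fun x => X x a) (x : Vec N) (v : Fin 2 → Vec N) :
    extd (fun x (v : Fin 1 → Vec N) => ∑ a, ∑ b, g x a b * X x a * (v 0) b) x v
      = ∑ a, ∑ b, curl g X x a b * v 0 a * v 1 b := by
  have h : ∀ u z : Vec N, fderiv ℝ (fun y => ∑ a, ∑ b, g y a b * X y a * u b) x z
      = ∑ a, ∑ b, pd (lower g X b) a x * z a * u b := fun u z => by
    have h0 : (fun y => ∑ a, ∑ b, g y a b * X y a * u b)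
        = fun y => ∑ b, u b * lower g X b y := by
      ext y
      rw [Finset.sum_comm]
      simp only [lower, Finset.mul_sum]
      exact Finset.sum_congr rfl fun b _ => Finset.sum_congr rfl fun a _ => by ring
    have hd : ∀ b, DifferentiableAt ℝ (lower g X b) x := fun b =>
      differentiableAt_of_contDiff (contDiff_lower hgsm hX b)
    rw [h0, fderiv_apply_eq_sum_pd]
    refine Finset.sum_congr rfl fun a _ => ?_
    rw [pd_sum _ fun b _ => (hd b).const_mul (u b), Finset.mul_sum]
    refine Finset.sum_congr rfl fun b _ => ?_
    rw [pd_const_mul _ (hd b)]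
    ring
  simp only [extd, Fin.sum_univ_two, Nat.reduceAdd]
  simp only [h, curl, Matrix.of_apply, sub_mul, Finset.sum_sub_distrib]
  rw [sub_eq_add_neg]
  congr 1
  · simp
  · rw [Finset.sum_comm]
    simp only [Fin.val_one, pow_one, neg_mul, one_mul, ← Finset.sum_neg_distrib,
      show (1 : Fin 2).succAbove 0 = 0 from rfl]
    exact Finset.sum_congr rfl fun b _ => Finset.sum_congr rfl fun a _ => by ring

section metric

variable {m : ℕ} {g ginv : Vec (2 + m) → Fin (2 + m) → Fin (2 + m) → ℝ}
  {X : Vec (2 + m) → Vec (2 + m)} {K : Fin m → Vec (2 + m) → Vec (2 + m)}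

/-- The twist form in terms of the contraction `bivDet`. -/
theorem wedge_extd_det
    (hgsm : ∀ a b, ContDiff ℝ (⊤ : ℕ∞) fun x => g x a b)
    (hX : ∀ a, ContDiff ℝ (⊤ : ℕ∞) fun x => X x a)
    (hgsymm : ∀ x a b, g x a b = g x b a)
    (hginv : ∀ x a b, (∑ c, ginv x a c * g x c b) = if a = b then (1 : ℝ) else 0)
    (x : Vec (2 + m)) (v : Fin (2 + m) → Vec (2 + m)) :
    wedge (extd fun x (v : Fin 1 → Vec (2 + m)) => ∑ a, ∑ b, g x a b * X x a * (v 0) b)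
      (fun x v => Matrix.det (Matrix.of fun μ ν : Fin m => ∑ a, ∑ b, g x a b * K μ x a * (v ν) b))
      x v
      = (2 : ℝ)⁻¹ * ((Matrix.of v).det * ((Matrix.of (g x)).det
        * bivDet (curlUp g ginv X x) fun i => K i x)) := by
  have hG : (Matrix.of (g x)).transpose = Matrix.of (g x) := by
    ext a b; exact hgsymm x b a
  have h1 : Matrix.of (g x) * curlUp g ginv X x * (Matrix.of (g x)).transpose = curl g X x := by
    rw [curlUp, hG, ← mul_assoc, ← mul_assoc, metric_mul_inv hginv, one_mul, mul_assoc,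
      inv_mul_metric hginv, mul_one]
  have h2 : ∀ (i : Fin m) (u : Vec (2 + m)), ∑ a, ∑ b, g x a b * K i x a * u b
      = (Matrix.of (g x)).mulVec (K i x) ⬝ᵥ u := fun i u => by
    rw [Finset.sum_comm]
    simp only [dotProduct, Matrix.mulVec, Matrix.of_apply, Finset.sum_mul]
    exact Finset.sum_congr rfl fun b _ => Finset.sum_congr rfl fun a _ => by
      rw [hgsymm x a b]
  have key := sum_perm_mul_det (curl g X x) (fun i => (Matrix.of (g x)).mulVec (K i x)) v
  rw [← bivDet_mul_transpose, h1]
  simp only [wedge, extd_one_form hgsm hX, h2]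
  have hm : (m.factorial : ℝ) ≠ 0 := Nat.cast_ne_zero.2 m.factorial_ne_zero
  refine (congrArg _ key).trans ?_
  rw [mul_inv, mul_assoc, inv_mul_cancel_left₀ hm]
  norm_num

theorem contDiff_append_pair (hK : ∀ μ a, ContDiff ℝ (⊤ : ℕ∞) fun x => K μ x a)
    (a b i j : Fin (2 + m)) : ContDiff ℝ (⊤ : ℕ∞) fun y =>
      Fin.append ![(Pi.single a 1 : Vec (2 + m)), Pi.single b 1] (fun i => K i y) i j := by
  refine Fin.addCases (fun i => ?_) (fun i => ?_) i
  · simpa using contDiff_const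
  · simpa using hK i j

/-- The derivative of the twist of commuting Killing fields. -/
theorem pd_twist {lam : ℝ} (hgsm : ∀ a b, ContDiff ℝ (⊤ : ℕ∞) fun x => g x a b)
    (hK : ∀ μ a, ContDiff ℝ (⊤ : ℕ∞) fun x => K μ x a)
    (hgsymm : ∀ x a b, g x a b = g x b a)
    (hginv : ∀ x a b, (∑ c, ginv x a c * g x c b) = if a = b then (1 : ℝ) else 0)
    (hKill : ∀ μ x a b, (∑ c, K μ x c * pd (fun y => g y a b) c x)
        + (∑ c, g x c b * pd (fun y => K μ y c) a x)
        + (∑ c, g x a c * pd (fun y => K μ y c) b x) = 0)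
    (hcomm : ∀ μ ν x a, (∑ b, (K μ x b * pd (fun y => K ν y a) b x
        - K ν x b * pd (fun y => K μ y a) b x)) = 0)
    (hEinstein : ∀ x b c, ricci g ginv x b c = lam * g x b c) (μ : Fin m)
    (e : Fin (2 + m)) (x : Vec (2 + m)) :
    pd (fun y => bivDet (curlUp g ginv (K μ) y) fun i => K i y) e x
      = - christoffelTrace g ginv e x * bivDet (curlUp g ginv (K μ) x) fun i => K i x := by
  have hHsm := contDiff_inv_metric hgsm hginv
  have hF := contDiff_curlUp hgsm hHsm (hK μ)
  have hrow := contDiff_append_pair hK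
  have hdet : ∀ a b : Fin (2 + m), DifferentiableAt ℝ (fun y => Matrix.detRowAlternating
      (Fin.append ![(Pi.single a 1 : Vec (2 + m)), Pi.single b 1] fun i => K i y)) x := fun a b =>
    differentiableAt_of_contDiff (contDiff_det (hrow a b))
  have h1 : pd (fun y => bivDet (curlUp g ginv (K μ) y) fun i => K i y) e x
      = bivDet (matPd (curlUp g ginv (K μ)) e x) (fun i => K i x)
        + ∑ i, bivDet (curlUp g ginv (K μ) x) (Function.update (fun i => K i x) i
            ((jac (K i) x).mulVec (Pi.single e 1))) := by
    have hs : ∀ a b : Fin (2 + m), DifferentiableAt ℝ (fun y => curlUp g ginv (K μ) y a b *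
        Matrix.detRowAlternating
      (Fin.append ![(Pi.single a 1 : Vec (2 + m)), Pi.single b 1] fun i => K i y)) x :=
      fun a b => (differentiableAt_of_contDiff (hF a b)).mul (hdet a b)
    have hp : ∀ a b : Fin (2 + m), pd (fun y => Matrix.detRowAlternating
        (Fin.append ![(Pi.single a 1 : Vec (2 + m)), Pi.single b 1] fun i => K i y)) e x
        = ∑ i, Matrix.detRowAlternating
        (Fin.append ![(Pi.single a 1 : Vec (2 + m)), Pi.single b 1]
          (Function.update (fun i => K i x) i ((jac (K i) x).mulVec (Pi.single e 1)))) := by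
      intro a b
      rw [pd_det fun i j => differentiableAt_of_contDiff (hrow a b i j), Fin.sum_univ_add]
      have z : ∑ i : Fin 2, Matrix.detRowAlternating (Function.update
          (Fin.append ![(Pi.single a 1 : Vec (2 + m)), Pi.single b 1] fun i => K i x)
          (Fin.castAdd m i) fun j => pd (fun y =>
          Fin.append ![(Pi.single a 1 : Vec (2 + m)), Pi.single b 1] (fun i => K i y)
            (Fin.castAdd m i) j) e x) = 0 := by
        refine Finset.sum_eq_zero fun i _ => ?_
        simp only [Fin.append_left, pd_const]
        exact AlternatingMap.map_update_zero _ _ _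
      rw [z, zero_add]
      refine Finset.sum_congr rfl fun i _ => ?_
      simp only [Fin.append_right, update_append_natAdd, Matrix.mulVec_single_one]
      rfl
    simp only [bivDet]
    rw [pd_sum _ fun a _ => DifferentiableAt.fun_sum fun b _ => hs a b]
    simp only [pd_sum _ fun b _ => hs _ b]
    simp only [pd_mul (differentiableAt_of_contDiff (hF _ _)) (hdet _ _), hp,
      Finset.sum_add_distrib]
    congr 1
    simp only [Finset.mul_sum]
    exact sum_rotate _

  have key := bivDet_add_sum_update_eq_zero (curlUp g ginv (K μ) x)
    (fun e => matPd (curlUp g ginv (K μ)) e x + christoffelTrace g ginv e x •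
      curlUp g ginv (K μ) x) (fun i => K i x) (fun i => jac (K i) x) μ (-2 * lam)
    (fun b => div_curlUp hgsm (hK μ) hgsymm hginv (hKill μ) hEinstein x b)
    (fun d a b => by
      have := curlUp_antisymm (X := K μ) hgsymm hginv
      have h : (fun y => curlUp g ginv (K μ) y a b) = fun y => - 1 * curlUp g ginv (K μ) y b a := by
        ext y; rw [this]; ring
      simp only [matPd, Matrix.add_apply, Matrix.smul_apply, Matrix.of_apply, smul_eq_mul]
      rw [h, pd_const_mul _ (differentiableAt_of_contDiff (hF b a)), this x a b]
      ring)
    (fun i => by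
      simp only [smul_add, Finset.sum_add_distrib, smul_smul]
      rw [lie_curlUp hgsm (hK i) (hK μ) hginv (hKill i) (hcomm i μ), ← Finset.sum_smul,
        killing_div hgsymm hginv (hKill i), neg_smul, sub_eq_add_neg])
    (fun i j => by
      ext a
      have := hcomm i j x a
      rw [Finset.sum_sub_distrib] at this
      simp only [Matrix.mulVec, dotProduct, jac, Matrix.of_apply, mul_comm (pd _ _ _)]
      linarith) e
  rw [bivDet_add, bivDet_smul] at key
  rw [h1]
  linarith

/-- The twist of commuting Killing fields of an Einstein metric vanishes everywhere if it vanishes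
at one point. -/
theorem twist_eq_zero {lam : ℝ} (hgsm : ∀ a b, ContDiff ℝ (⊤ : ℕ∞) fun x => g x a b)
    (hK : ∀ μ a, ContDiff ℝ (⊤ : ℕ∞) fun x => K μ x a)
    (hgsymm : ∀ x a b, g x a b = g x b a)
    (hginv : ∀ x a b, (∑ c, ginv x a c * g x c b) = if a = b then (1 : ℝ) else 0)
    (hKill : ∀ μ x a b, (∑ c, K μ x c * pd (fun y => g y a b) c x)
        + (∑ c, g x c b * pd (fun y => K μ y c) a x)
        + (∑ c, g x a c * pd (fun y => K μ y c) b x) = 0)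
    (hcomm : ∀ μ ν x a, (∑ b, (K μ x b * pd (fun y => K ν y a) b x
        - K ν x b * pd (fun y => K μ y a) b x)) = 0)
    (hEinstein : ∀ x b c, ricci g ginv x b c = lam * g x b c) (μ : Fin m) {p : Vec (2 + m)}
    (hp : bivDet (curlUp g ginv (K μ) p) (fun i => K i p) = 0) (x : Vec (2 + m)) :
    bivDet (curlUp g ginv (K μ) x) (fun i => K i x) = 0 := by
  have hHsm := contDiff_inv_metric hgsm hginv
  have hf : ContDiff ℝ (⊤ : ℕ∞) fun y => bivDet (curlUp g ginv (K μ) y) fun i => K i y :=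
    ContDiff.sum fun a _ => ContDiff.sum fun b _ =>
      (contDiff_curlUp hgsm hHsm (hK μ) a b).mul (contDiff_det (contDiff_append_pair hK a b))
  exact eq_zero_of_pd_eq_mul (hf.differentiable (by simp))
    (c := fun e x => - christoffelTrace g ginv e x)
    (fun e => (contDiff_christoffelTrace hgsm hHsm e).continuous.neg)
    (pd_twist hgsm hK hgsymm hginv hKill hcomm hEinstein μ) hp x

end metric

/-- Local form of the Kundt–Trümper theorem with `m` fields in dimension `N = 2 + m`. -/
theorem wedge_extd_eq_zero {N m : ℕ} (hN : N = 2 + m) {lam : ℝ}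
    {g ginv : Vec N → Fin N → Fin N → ℝ} {K : Fin m → Vec N → Vec N}
    (hgsm : ∀ a b, ContDiff ℝ (⊤ : ℕ∞) fun x => g x a b)
    (hK : ∀ μ a, ContDiff ℝ (⊤ : ℕ∞) fun x => K μ x a)
    (hgsymm : ∀ x a b, g x a b = g x b a)
    (hginv : ∀ x a b, (∑ c, ginv x a c * g x c b) = if a = b then (1 : ℝ) else 0)
    (hKill : ∀ μ x a b, (∑ c, K μ x c * pd (fun y => g y a b) c x)
        + (∑ c, g x c b * pd (fun y => K μ y c) a x)
        + (∑ c, g x a c * pd (fun y => K μ y c) b x) = 0)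
    (hcomm : ∀ μ ν x a, (∑ b, (K μ x b * pd (fun y => K ν y a) b x
        - K ν x b * pd (fun y => K μ y a) b x)) = 0)
    (hEinstein : ∀ x b c, ricci g ginv x b c = lam * g x b c)
    {p : Vec N} (hp : ∀ v : Fin m → Vec N, Matrix.det (Matrix.of fun μ ν : Fin m =>
        ∑ a, ∑ b, g p a b * K μ p a * (v ν) b) = 0)
    (μ : Fin m) (x : Vec N) (v : Fin (2 + m) → Vec N) :
    wedge (extd fun x (v : Fin 1 → Vec N) => ∑ a, ∑ b, g x a b * K μ x a * (v 0) b)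
      (fun x v => Matrix.det (Matrix.of fun μ ν : Fin m => ∑ a, ∑ b, g x a b * K μ x a * (v ν) b))
      x v = 0 := by
  subst hN
  have h := wedge_extd_det (K := K) hgsm (hK μ) hgsymm hginv
  rw [h, twist_eq_zero hgsm hK hgsymm hginv hKill hcomm hEinstein μ (p := p)]
  · simp
  have h1 := h p fun i => Pi.single i 1
  have hone : Matrix.of (fun i : Fin (2 + m) => (Pi.single i 1 : Vec (2 + m))) = 1 := by
    ext i j
    simp [Matrix.one_apply, Pi.single_apply, eq_comm]
  rw [hone, Matrix.det_one, one_mul] at h1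
  simp only [wedge, hp, mul_zero, Finset.sum_const_zero] at h1
  have := metric_det_ne_zero hginv p
  simpa [this] using h1.symm

/-- **Kundt–Trümper/Papapetrou integrability.** If an `(n+1)`-dimensional
Lorentzian metric satisfies the vacuum Einstein equations with cosmological constant
(`Ric = λ g`) and admits `n-1` linearly independent commuting Killing vector fields
`K₀, …, K_{n-2}` whose wedge `w = K₀^♭ ∧ … ∧ K_{n-2}^♭` vanishes at some point, then the
orthogonal-integrability condition `dK_μ ∧ K₀ ∧ … ∧ K_{n-2} = 0` holds everywhere. -/
theorem stmt_3 (n : ℕ) (hn : 2 ≤ n) (lam : ℝ)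
    (g ginv : Vec (n + 1) → Fin (n + 1) → Fin (n + 1) → ℝ)
    (K : Fin (n - 1) → Vec (n + 1) → Vec (n + 1))
    (hgsm : ∀ a b, ContDiff ℝ (⊤ : ℕ∞) fun x => g x a b)
    (hKsm : ∀ μ a, ContDiff ℝ (⊤ : ℕ∞) fun x => K μ x a)
    (hgsymm : ∀ x a b, g x a b = g x b a)
    (hginv : ∀ x a b, (∑ c, ginv x a c * g x c b) = if a = b then (1 : ℝ) else 0)
    (hli : LinearIndependent ℝ K)
    -- Killing equations: `L_{K_μ} g = 0`
    (hKilling : ∀ μ x a b,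
      (∑ c, K μ x c * pd (fun y => g y a b) c x)
        + (∑ c, g x c b * pd (fun y => K μ y c) a x)
        + (∑ c, g x a c * pd (fun y => K μ y c) b x) = 0)
    -- the Killing fields commute: `[K_μ, K_ν] = 0`
    (hcomm : ∀ μ ν x a,
      (∑ b, (K μ x b * pd (fun y => K ν y a) b x
        - K ν x b * pd (fun y => K μ y a) b x)) = 0)
    -- vacuum Einstein equations with cosmological constant: `Ric = λ g`
    (hEinstein : ∀ x b c, ricci g ginv x b c = lam * g x b c)
    -- the lowered one-forms `K_μ^♭`
    (Kb : Fin (n - 1) → FormField (n + 1) 1)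
    (hKb : Kb = fun μ x v => ∑ a, ∑ b, g x a b * K μ x a * (v 0) b)
    -- `w = K₀^♭ ∧ … ∧ K_{n-2}^♭`
    (w : FormField (n + 1) (n - 1))
    (hw : w = fun x v => Matrix.det (Matrix.of fun μ ν : Fin (n - 1) =>
        ∑ a, ∑ b, g x a b * K μ x a * (v ν) b))
    -- the degeneracy set `{p : K₀ ∧ … ∧ K_{n-2}|_p = 0}` is non-empty
    (hdeg : ∃ p : Vec (n + 1), ∀ v : Fin (n - 1) → Vec (n + 1), w p v = 0) :
    ∀ μ, ∀ x, ∀ v : Fin (2 + (n - 1)) → Vec (n + 1),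
      wedge (extd (Kb μ)) w x v = 0 := by
  subst hKb hw
  obtain ⟨p, hp⟩ := hdeg
  exact wedge_extd_eq_zero (by omega) hgsm hKsm hgsymm hginv hKilling hcomm hEinstein hp

end
end

section
/- Let K₀, …, K_{s-1} be commuting Killing vector fields on an (n+1)-dimensional Lorentzian manifold satisfying the orthogonal integrability condition dK_μ ∧ K₀ ∧ … ∧ K_{s-1} = 0 for every μ. Let w := K₀^♭ ∧ … ∧ K_{s-1}^♭ and W := -det(g(K_μ, K_ν))_{μ,ν=0,…,s-1}. Then w ∧ dW = (-1)^s W dw. -/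
open Finset

noncomputable section

/-- The block permutation of `Fin (k + l)` given by permutations of the two blocks. -/
def blockPerm {k l : ℕ} (a : Equiv.Perm (Fin k)) (b : Equiv.Perm (Fin l)) :
    Equiv.Perm (Fin (k + l)) :=
  finSumFinEquiv.permCongr (Equiv.Perm.sumCongr a b)

lemma blockPerm_castAdd {k l : ℕ} (a : Equiv.Perm (Fin k)) (b : Equiv.Perm (Fin l)) (i : Fin k) :
    blockPerm a b (Fin.castAdd l i) = Fin.castAdd l (a i) := by
  simp [blockPerm, Equiv.permCongr_apply]

lemma blockPerm_natAdd {k l : ℕ} (a : Equiv.Perm (Fin k)) (b : Equiv.Perm (Fin l)) (j : Fin l) :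
    blockPerm a b (Fin.natAdd k j) = Fin.natAdd k (b j) := by
  simp [blockPerm, Equiv.permCongr_apply]

lemma sign_blockPerm {k l : ℕ} (a : Equiv.Perm (Fin k)) (b : Equiv.Perm (Fin l)) :
    Equiv.Perm.sign (blockPerm a b) = Equiv.Perm.sign a * Equiv.Perm.sign b := by
  rw [blockPerm, Equiv.Perm.sign_permCongr, Equiv.Perm.sign_sumCongr]

lemma exists_eq_blockPerm {k l : ℕ} (σ : Equiv.Perm (Fin (k + l)))
    (h : ∀ j, ∃ j', σ (Fin.natAdd k j) = Fin.natAdd k j') :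
    ∃ a b, σ = blockPerm a b := by
  have hmaps : Set.MapsTo (finSumFinEquiv.symm.permCongr σ)
      (Set.range Sum.inr) (Set.range (Sum.inr : Fin l → Fin k ⊕ Fin l)) := by
    rintro _ ⟨j, rfl⟩
    obtain ⟨j', hj'⟩ := h j
    exact ⟨j', by simp [Equiv.permCongr_apply, hj']⟩
  obtain ⟨⟨a, b⟩, hab⟩ := Equiv.Perm.mem_sumCongrHom_range_of_perm_mapsTo_inl
    ((Equiv.Perm.perm_mapsTo_inl_iff_mapsTo_inr _).2 hmaps)
  refine ⟨a, b, ?_⟩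
  have hab' : Equiv.Perm.sumCongr a b = finSumFinEquiv.symm.permCongr σ := hab
  rw [blockPerm, hab']
  ext i
  simp [Equiv.permCongr_apply]

lemma cast_sign_mul_self {ι : Type*} [Fintype ι] [DecidableEq ι] (a : Equiv.Perm ι) :
    ((Equiv.Perm.sign a : ℤ) : ℝ) * ((Equiv.Perm.sign a : ℤ) : ℝ) = 1 := by
  rcases Int.units_eq_one_or (Equiv.Perm.sign a) with h | h <;> simp [h]

/-- If the second factor vanishes as soon as one of its arguments comes from the first block,
then the vanishing of `α ∧ β` forces the product of the values on the blocks to vanish. -/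
lemma mul_eq_zero_of_wedge_eq_zero {n k l : ℕ} {α : FormField n k} {β : FormField n l}
    {x : Vec n} {v : Fin (k + l) → Vec n}
    (hα : ∀ (a : Equiv.Perm (Fin k)) (u : Fin k → Vec n),
      α x (fun i => u (a i)) = ((Equiv.Perm.sign a : ℤ) : ℝ) * α x u)
    (hβ : ∀ (b : Equiv.Perm (Fin l)) (u : Fin l → Vec n),
      β x (fun j => u (b j)) = ((Equiv.Perm.sign b : ℤ) : ℝ) * β x u)
    (hβ0 : ∀ u : Fin l → Vec n, (∃ i j, u j = v (Fin.castAdd l i)) → β x u = 0)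
    (h : wedge α β x v = 0) :
    α x (fun i => v (Fin.castAdd l i)) * β x (fun j => v (Fin.natAdd k j)) = 0 := by
  set c := α x (fun i => v (Fin.castAdd l i)) * β x (fun j => v (Fin.natAdd k j)) with hc
  set t : Equiv.Perm (Fin (k + l)) → ℝ := fun σ => ((Equiv.Perm.sign σ : ℤ) : ℝ) *
        (α x fun i => v (σ (Fin.castAdd l i))) *
        (β x fun j => v (σ (Fin.natAdd k j))) with ht
  have hsum : ∑ σ, t σ = 0 := by
    refine (mul_eq_zero.1 h).resolve_left (inv_ne_zero ?_)
    exact_mod_cast mul_ne_zero k.factorial_ne_zero l.factorial_ne_zero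
  have hterm : ∀ σ, t σ = 0 ∨ t σ = c := by
    intro σ
    by_cases hσ : ∀ j, ∃ j', σ (Fin.natAdd k j) = Fin.natAdd k j'
    · right
      obtain ⟨a, b, rfl⟩ := exists_eq_blockPerm σ hσ
      simp only [ht, blockPerm_castAdd, blockPerm_natAdd, sign_blockPerm]
      rw [hα a (fun i => v (Fin.castAdd l i)), hβ b (fun j => v (Fin.natAdd k j)), hc]
      push_cast
      linear_combination (α x (fun i => v (Fin.castAdd l i)) *
        β x (fun j => v (Fin.natAdd k j))) * (((Equiv.Perm.sign b : ℤ) : ℝ) ^ 2 *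
          cast_sign_mul_self a + cast_sign_mul_self b)
    · left
      push Not at hσ
      obtain ⟨j, hj⟩ := hσ
      have : ∃ i, σ (Fin.natAdd k j) = Fin.castAdd l i := by
        generalize σ (Fin.natAdd k j) = m at hj
        induction m using Fin.addCases with
        | left i => exact ⟨i, rfl⟩
        | right i => exact absurd rfl (hj i)
      obtain ⟨i, hi⟩ := this
      simp only [ht]
      rw [hβ0 _ ⟨i, j, by rw [hi]⟩, mul_zero]
  have hnn : ∀ σ ∈ univ, 0 ≤ t σ * c := by
    intro σ _
    rcases hterm σ with h0 | h0 <;> rw [h0]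
    · simp
    · exact mul_self_nonneg c
  have hz : ∑ σ, t σ * c = 0 := by rw [← sum_mul, hsum, zero_mul]
  have h1 := (sum_eq_zero_iff_of_nonneg hnn).1 hz 1 (mem_univ _)
  have : t 1 = c := by simp [ht, hc]
  rw [this] at h1
  exact mul_self_eq_zero.1 h1

/-- Wedging the determinant of `s` covectors with one more covector gives the determinant of
all `s + 1` covectors, expanded along the last one. -/
lemma sum_perm_sign_mul_det (s : ℕ) (N : Matrix (Fin s) (Fin (s + 1)) ℝ) (r : Fin (s + 1) → ℝ) :
    ((s.factorial : ℝ) * ((0 + 1).factorial : ℝ))⁻¹ *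
      ∑ σ : Equiv.Perm (Fin (s + (0 + 1))), ((Equiv.Perm.sign σ : ℤ) : ℝ) *
        (Matrix.of fun μ ν => N μ (σ (Fin.castAdd (0 + 1) ν))).det *
        r (σ (Fin.natAdd s 0))
      = (-1) ^ s * ∑ i : Fin (s + 1), (-1) ^ (i : ℕ) * (r i * (N.submatrix id i.succAbove).det) := by
  let M : Matrix (Fin (s + 1)) (Fin (s + 1)) ℝ :=
    Fin.snoc (α := fun _ => Fin (s + 1) → ℝ) N r
  have hMlast : M (Fin.last s) = r := Fin.snoc_last (α := fun _ => Fin (s + 1) → ℝ) r N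
  have hMcast : ∀ μ : Fin s, M μ.castSucc = N μ := fun μ =>
    Fin.snoc_castSucc (α := fun _ => Fin (s + 1) → ℝ) r N μ
  have hlap : M.det = (-1) ^ s *
      ∑ i : Fin (s + 1), (-1) ^ (i : ℕ) * (r i * (N.submatrix id i.succAbove).det) := by
    rw [Matrix.det_succ_row M (Fin.last s), mul_sum]
    refine sum_congr rfl fun i _ => ?_
    have h2 : M.submatrix (Fin.last s).succAbove i.succAbove = N.submatrix id i.succAbove := by
      ext a b
      simp [Fin.succAbove_last, hMcast]
    rw [hMlast, h2, Fin.val_last, pow_add]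
    ring
  have hdet : ∀ τ : Equiv.Perm (Fin s),
      ∑ σ : Equiv.Perm (Fin (s + 1)), ((Equiv.Perm.sign σ : ℤ) : ℝ) *
        (((Equiv.Perm.sign τ : ℤ) : ℝ) * ∏ μ, N μ (σ (Fin.castAdd 1 (τ μ)))) *
        r (σ (Fin.natAdd s 0)) = M.det := by
    intro τ
    rw [← Matrix.det_transpose, Matrix.det_apply']
    refine (sum_congr rfl fun σ _ => ?_).trans
      (Equiv.sum_comp (Equiv.mulRight (blockPerm τ (1 : Equiv.Perm (Fin 1)))) _)
    rw [Fin.prod_univ_castSucc]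
    have h0 : ∀ μ, (σ * blockPerm τ (1 : Equiv.Perm (Fin 1))) (Fin.castSucc μ)
        = σ (Fin.castAdd 1 (τ μ)) := fun μ => by
      rw [Equiv.Perm.mul_apply]
      exact congrArg σ (blockPerm_castAdd τ 1 μ)
    have h1 : (σ * blockPerm τ (1 : Equiv.Perm (Fin 1))) (Fin.last s) = σ (Fin.natAdd s 0) := by
      rw [Equiv.Perm.mul_apply]
      exact congrArg σ (blockPerm_natAdd τ 1 0)
    simp only [Equiv.coe_mulRight, h0, h1, Equiv.Perm.sign_mul, sign_blockPerm,
      Matrix.transpose_apply, hMlast, hMcast]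
    push_cast
    simp only [Equiv.Perm.sign_one, Units.val_one, Int.cast_one]
    ring
  have hswap : ∑ σ : Equiv.Perm (Fin (s + (0 + 1))), ((Equiv.Perm.sign σ : ℤ) : ℝ) *
        (Matrix.of fun μ ν => N μ (σ (Fin.castAdd (0 + 1) ν))).det *
        r (σ (Fin.natAdd s 0)) = ∑ τ : Equiv.Perm (Fin s), M.det := by
    rw [← sum_congr rfl fun τ _ => hdet τ, sum_comm]
    refine sum_congr rfl fun σ _ => ?_
    rw [← Matrix.det_transpose, Matrix.det_apply', mul_sum, sum_mul]
    rfl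
  rw [hswap, ← hlap, sum_const, card_univ, Fintype.card_perm, Fintype.card_fin, nsmul_eq_mul]
  have : (s.factorial : ℝ) ≠ 0 := by exact_mod_cast s.factorial_ne_zero
  field_simp
  simp

/-- The alternating sum of determinants obtained by inserting a symmetric array in one row
vanishes. -/
lemma sum_det_updateRow_of_symm {s : ℕ} (M : Matrix (Fin s) (Fin (s + 1)) ℝ) (μ : Fin s)
    (B : Fin (s + 1) → Fin (s + 1) → ℝ) (hB : ∀ i j, B i j = B j i) :
    ∑ i : Fin (s + 1), (-1 : ℝ) ^ (i : ℕ) *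
      ((M.submatrix id i.succAbove).updateRow μ fun j => B i (i.succAbove j)).det = 0 := by
  let P : Fin (s + 1) → Fin (s + 1) → Matrix (Fin (s + 1)) (Fin (s + 1)) ℝ := fun a b =>
    Fin.cons (α := fun _ => Fin (s + 1) → ℝ) (Pi.single a 1) (M.updateRow μ (Pi.single b 1))
  have hP0 : ∀ a b, P a b 0 = Pi.single a 1 := fun _ _ => rfl
  have hPs : ∀ a b (i : Fin s), P a b i.succ = M.updateRow μ (Pi.single b 1) i := fun _ _ _ => rfl
  have hP : ∀ a b, (P a b).det = -(P b a).det := by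
    intro a b
    have : P a b = (P b a).submatrix (Equiv.swap 0 μ.succ) id := by
      ext i j
      refine Fin.cases ?_ (fun i => ?_) i
      · simp [hP0, hPs]
      · by_cases h : i = μ
        · subst h; simp [hP0, hPs]
        · have : Equiv.swap 0 μ.succ i.succ = i.succ :=
            Equiv.swap_apply_of_ne_of_ne (Fin.succ_ne_zero i) (by simpa using h)
          simp [hPs, this, h]
    rw [this, Matrix.det_permute, Equiv.Perm.sign_swap (Fin.succ_ne_zero μ).symm]
    simp
  have hexp : ∀ a b, (P a b).det = (-1 : ℝ) ^ (a : ℕ) *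
      ((M.submatrix id a.succAbove).updateRow μ
        fun j => (Pi.single b 1 : Fin (s + 1) → ℝ) (a.succAbove j)).det := by
    intro a b
    rw [Matrix.det_succ_row_zero, sum_eq_single a]
    · have : (P a b).submatrix Fin.succ a.succAbove = (M.submatrix id a.succAbove).updateRow μ
        fun j => (Pi.single b 1 : Fin (s + 1) → ℝ) (a.succAbove j) := by
        ext i j
        by_cases h : i = μ
        · subst h; simp [hPs]
        · simp [hPs, h]
      rw [this, hP0]
      simp
    · intro c _ hc
      simp [hP0, hc]
    · simp
  have hrow : ∀ i : Fin (s + 1), (-1 : ℝ) ^ (i : ℕ) *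
      ((M.submatrix id i.succAbove).updateRow μ fun j => B i (i.succAbove j)).det
      = ∑ b, B i b * (P i b).det := by
    intro i
    have : (fun j => B i (i.succAbove j)) = ∑ b, B i b •
        (fun j => (Pi.single b 1 : Fin (s + 1) → ℝ) (i.succAbove j)) := by
      ext j
      simp [Finset.sum_apply, Pi.single_apply]
    rw [this]
    have hl : ∀ f : Fin (s + 1) → Fin s → ℝ,
        ((M.submatrix id i.succAbove).updateRow μ (∑ b, f b)).det
          = ∑ b, ((M.submatrix id i.succAbove).updateRow μ (f b)).det := fun f =>
      (Matrix.detRowAlternating : (Fin s → ℝ) [⋀^Fin s]→ₗ[ℝ] ℝ).toMultilinearMap.map_update_sum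
        univ μ f (M.submatrix id i.succAbove)
    rw [hl, mul_sum]
    refine sum_congr rfl fun b _ => ?_
    rw [Matrix.det_updateRow_smul, hexp]
    ring
  rw [sum_congr rfl fun i _ => hrow i]
  have h1 : ∑ i, ∑ b, B i b * (P i b).det = -∑ i, ∑ b, B i b * (P i b).det := by
    conv_lhs => rw [sum_comm]
    rw [← sum_neg_distrib]
    refine sum_congr rfl fun i _ => ?_
    rw [← sum_neg_distrib]
    refine sum_congr rfl fun b _ => ?_
    rw [hP b i, hB b i]
    ring
  linarith

/-- The structure equation of the Killing covectors: contracting `Ω μ` with the vectors `k ν`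
gives the differentials of the Gram matrix, and these contractions determine `Ω μ`. -/
lemma det_mul_eq_sum_of_contraction {E : Type*} [AddCommGroup E] [Module ℝ E] {s : ℕ}
    (θ : Fin s → E →ₗ[ℝ] ℝ) (k : Fin s → E) (Ω : Fin s → E →ₗ[ℝ] E →ₗ[ℝ] ℝ)
    (dG : Fin s → Fin s → E → ℝ) (G : Matrix (Fin s) (Fin s) ℝ)
    (hG : ∀ μ ν, θ μ (k ν) = G μ ν) (hdet : G.det ≠ 0)
    (hdG : ∀ μ ν u, dG μ ν u = dG ν μ u) (hanti : ∀ μ u v, Ω μ u v = -Ω μ v u)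
    (hΩ : ∀ μ ν v, Ω μ (k ν) v = -dG μ ν v)
    (hker : ∀ μ u v, (∀ ν, θ ν u = 0) → (∀ ν, θ ν v = 0) → Ω μ u v = 0)
    (μ : Fin s) (u v : E) :
    G.det * Ω μ u v = ∑ ν, (dG μ ν u * ∑ l, G.adjugate ν l * θ l v
      - dG μ ν v * ∑ l, G.adjugate ν l * θ l u) := by
  have hskew : ∀ μ ν l, dG μ ν (k l) = -dG μ l (k ν) := by
    intro μ ν l
    linarith [hanti μ (k ν) (k l), hΩ μ ν (k l), hΩ μ l (k ν)]
  have hzero : ∀ μ ν l, dG μ ν (k l) = 0 := by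
    intro μ ν l
    linarith [hskew μ ν l, hdG μ l (k ν), hskew l μ ν, hdG l ν (k μ), hskew ν l μ,
      hdG ν μ (k l)]
  let η : Fin s → E → ℝ := fun ν u => ∑ l, G.adjugate ν l * θ l u
  let P : E → E := fun u => G.det • u - ∑ ν, η ν u • k ν
  have hP : ∀ u l, θ l (P u) = 0 := by
    intro u l
    have hadj : ∀ m, ∑ ν, G l ν * G.adjugate ν m = if l = m then G.det else 0 := by
      intro m
      have := congrFun (congrFun (Matrix.mul_adjugate G) l) m
      simpa [Matrix.mul_apply, Matrix.one_apply] using this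
    have : ∑ ν, η ν u * G l ν = G.det * θ l u := by
      simp only [η, sum_mul]
      rw [sum_comm]
      calc ∑ m, ∑ ν, G.adjugate ν m * θ m u * G l ν
          = ∑ m, (∑ ν, G l ν * G.adjugate ν m) * θ m u := by
            refine sum_congr rfl fun m _ => ?_
            rw [sum_mul]
            exact sum_congr rfl fun ν _ => by ring
        _ = G.det * θ l u := by simp [hadj]
    simp [P, map_sub, map_sum, hG, this]
  have h0 := hker μ (P u) (P v) (hP u) (hP v)
  have h1 : Ω μ (P u) (P v) = G.det * (G.det * Ω μ u v)
      - G.det * (∑ ν, (dG μ ν u * η ν v - dG μ ν v * η ν u)) := by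
    have hk : ∀ ν, Ω μ (k ν) (P v) = -(G.det * dG μ ν v) := by
      intro ν
      have hkk : ∀ l, Ω μ (k ν) (k l) = 0 := fun l => by rw [hΩ, hzero, neg_zero]
      simp only [P, map_sub, map_smul, map_sum, hkk, smul_eq_mul, mul_zero, sum_const_zero,
        sub_zero]
      rw [hΩ, mul_neg]
    have hu : ∀ ν, Ω μ u (k ν) = dG μ ν u := fun ν => by rw [hanti, hΩ, neg_neg]
    have : Ω μ (P u) (P v) = G.det * Ω μ u (P v) - ∑ ν, η ν u * Ω μ (k ν) (P v) := by
      conv_lhs => rw [show P u = G.det • u - ∑ ν, η ν u • k ν from rfl]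
      simp [map_sub, map_sum, LinearMap.sub_apply, LinearMap.sum_apply]
    rw [this]
    have h2 : Ω μ u (P v) = G.det * Ω μ u v - ∑ ν, η ν v * dG μ ν u := by
      simp [P, map_sub, map_sum, hu]
    simp only [h2, hk, sum_sub_distrib, mul_sub, mul_neg, sum_neg_distrib, mul_sum]
    have e1 : ∑ ν, η ν u * (G.det * dG μ ν v) = ∑ ν, G.det * (dG μ ν v * η ν u) :=
      sum_congr rfl fun ν _ => by ring
    have e2 : ∑ ν, G.det * (η ν v * dG μ ν u) = ∑ ν, G.det * (dG μ ν u * η ν v) :=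
      sum_congr rfl fun ν _ => by ring
    rw [e1, e2]
    ring
  rw [h1, ← mul_sub] at h0
  exact sub_eq_zero.1 ((mul_eq_zero.1 h0).resolve_left hdet)

/-- The exterior derivative of a determinant of covectors obeying the structure equation `hA`. -/
lemma det_mul_sum_det_updateRow {E : Type*} [AddCommGroup E] [Module ℝ E] {s : ℕ}
    (θ : Fin s → E →ₗ[ℝ] ℝ) (A : Fin s → E → E → ℝ)
    (dG : Fin s → Fin s → E → ℝ) (G : Matrix (Fin s) (Fin s) ℝ)
    (hA : ∀ μ u v, G.det * (A μ u v - A μ v u) =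
      ∑ ν, (dG μ ν u * ∑ l, G.adjugate ν l * θ l v - dG μ ν v * ∑ l, G.adjugate ν l * θ l u))
    (v : Fin (s + 1) → E) :
    G.det * ∑ i : Fin (s + 1), (-1 : ℝ) ^ (i : ℕ) * ∑ μ,
      ((Matrix.of fun μ ν => θ μ (v (i.succAbove ν))).updateRow μ
        fun ν => A μ (v i) (v (i.succAbove ν))).det
      = ∑ i : Fin (s + 1), (-1 : ℝ) ^ (i : ℕ) * ((∑ μ, ∑ ν, G.adjugate ν μ * dG μ ν (v i)) *
        (Matrix.of fun μ ν => θ μ (v (i.succAbove ν))).det) := by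
  let M : Matrix (Fin s) (Fin (s + 1)) ℝ := Matrix.of fun μ j => θ μ (v j)
  let C : Fin s → Fin (s + 1) → Fin (s + 1) → ℝ := fun μ i j =>
    ∑ ν, dG μ ν (v i) * ∑ l, G.adjugate ν l * θ l (v j)
  have hsymm : ∀ μ i j, G.det * A μ (v i) (v j) - C μ i j
      = G.det * A μ (v j) (v i) - C μ j i := by
    intro μ i j
    have := hA μ (v i) (v j)
    rw [sum_sub_distrib] at this
    simp only [C]
    linarith
  have hC : ∀ μ i, ((M.submatrix id i.succAbove).updateRow μ fun j => C μ i (i.succAbove j)).det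
      = (∑ ν, G.adjugate ν μ * dG μ ν (v i)) * (M.submatrix id i.succAbove).det := by
    intro μ i
    have : (fun j => C μ i (i.succAbove j)) =
        ∑ l, (∑ ν, G.adjugate ν l * dG μ ν (v i)) • (M.submatrix id i.succAbove) l := by
      ext j
      simp only [C, M, Finset.sum_apply, Pi.smul_apply, smul_eq_mul, Matrix.submatrix_apply,
        Matrix.of_apply, id, mul_sum, sum_mul]
      rw [sum_comm]
      exact sum_congr rfl fun l _ => sum_congr rfl fun ν _ => by ring
    rw [this, Matrix.det_updateRow_sum, smul_eq_mul]
  have hrow : ∀ μ i, G.det * ((M.submatrix id i.succAbove).updateRow μ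
        fun ν => A μ (v i) (v (i.succAbove ν))).det
      = ((M.submatrix id i.succAbove).updateRow μ fun j =>
          G.det * A μ (v i) (v (i.succAbove j)) - C μ i (i.succAbove j)).det
        + (∑ ν, G.adjugate ν μ * dG μ ν (v i)) * (M.submatrix id i.succAbove).det := by
    intro μ i
    rw [← hC, ← Matrix.det_updateRow_add, ← Matrix.det_updateRow_smul]
    congr 2
    ext j
    simp
  have hzero := fun μ => sum_det_updateRow_of_symm M μ
    (fun i j => G.det * A μ (v i) (v j) - C μ i j) (hsymm μ)
  calc _ = ∑ i : Fin (s + 1), ∑ μ, (-1 : ℝ) ^ (i : ℕ) * (G.det *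
        ((M.submatrix id i.succAbove).updateRow μ
          fun ν => A μ (v i) (v (i.succAbove ν))).det) := by
        rw [mul_sum]
        refine sum_congr rfl fun i _ => ?_
        rw [mul_sum, mul_sum]
        refine sum_congr rfl fun μ _ => ?_
        rw [mul_left_comm]
        rfl
    _ = ∑ μ, (∑ i : Fin (s + 1), (-1 : ℝ) ^ (i : ℕ) * ((M.submatrix id i.succAbove).updateRow μ
          fun j => G.det * A μ (v i) (v (i.succAbove j)) - C μ i (i.succAbove j)).det)
        + ∑ i : Fin (s + 1), ∑ μ, (-1 : ℝ) ^ (i : ℕ) *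
          ((∑ ν, G.adjugate ν μ * dG μ ν (v i)) * (M.submatrix id i.succAbove).det) := by
        rw [sum_comm (s := (univ : Finset (Fin s))), ← sum_add_distrib]
        refine sum_congr rfl fun i _ => ?_
        rw [← sum_add_distrib]
        refine sum_congr rfl fun μ _ => ?_
        rw [hrow, mul_add]
    _ = _ := by
        rw [sum_congr rfl fun μ _ => hzero μ, sum_const_zero, zero_add]
        refine sum_congr rfl fun i _ => ?_
        rw [sum_mul, mul_sum]
        rfl

/-- Jacobi's row formula for the derivative of a determinant. -/
lemma fderiv_det_apply {E : Type*} [NormedAddCommGroup E] [NormedSpace ℝ E] {s : ℕ}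
    (N : E → Matrix (Fin s) (Fin s) ℝ) (x u : E)
    (hN : ∀ i j, DifferentiableAt ℝ (fun y => N y i j) x) :
    fderiv ℝ (fun y => (N y).det) x u
      = ∑ i, ((N x).updateRow i fun j => fderiv ℝ (fun y => N y i j) x u).det := by
  let f : ContinuousMultilinearMap ℝ (fun _ : Fin s => Fin s → ℝ) ℝ :=
    { (Matrix.detRowAlternating : (Fin s → ℝ) [⋀^Fin s]→ₗ[ℝ] ℝ).toMultilinearMap with
      cont := Continuous.matrix_det (A := fun M : Fin s → Fin s → ℝ => Matrix.of M)
        continuous_id }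
  have hrow : ∀ i, HasFDerivAt (fun y => N y i)
      (ContinuousLinearMap.pi fun j => fderiv ℝ (fun y => N y i j) x) x := fun i =>
    hasFDerivAt_pi.2 fun j => (hN i j).hasFDerivAt
  have h : HasFDerivAt (fun y => (N y).det) _ x := HasFDerivAt.multilinear_comp f hrow
  rw [h.fderiv]
  simp only [_root_.sum_apply, ContinuousLinearMap.comp_apply]
  rfl

/-- The expression `∑ g_ab u^a v^b`. -/
def pair {m : ℕ} (g : Fin m → Fin m → ℝ) (u v : Vec m) : ℝ := ∑ a, ∑ b, g a b * u a * v b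

lemma pair_symm {m : ℕ} {g : Fin m → Fin m → ℝ} (hg : ∀ a b, g a b = g b a) (u v : Vec m) :
    pair g u v = pair g v u := by
  unfold pair
  rw [sum_comm]
  refine sum_congr rfl fun a _ => sum_congr rfl fun b _ => ?_
  rw [hg]
  ring

/-- `pair` as a bilinear map. -/
def pairₗ {m : ℕ} (g : Fin m → Fin m → ℝ) : Vec m →ₗ[ℝ] Vec m →ₗ[ℝ] ℝ :=
  LinearMap.mk₂ ℝ (pair g)
    (fun u u' v => by simp only [pair, Pi.add_apply, mul_add, add_mul, sum_add_distrib])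
    (fun c u v => by
      simp only [pair, Pi.smul_apply, smul_eq_mul, mul_sum]
      exact sum_congr rfl fun a _ => sum_congr rfl fun b _ => by ring)
    (fun u v v' => by simp only [pair, Pi.add_apply, mul_add, sum_add_distrib])
    (fun c u v => by
      simp only [pair, Pi.smul_apply, smul_eq_mul, mul_sum]
      exact sum_congr rfl fun a _ => sum_congr rfl fun b _ => by ring)

lemma pairₗ_apply {m : ℕ} (g : Fin m → Fin m → ℝ) (u v : Vec m) : pairₗ g u v = pair g u v := rfl

lemma fderiv_pair_apply {m : ℕ} {g : Vec m → Fin m → Fin m → ℝ} {X Y : Vec m → Vec m}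
    {x : Vec m} (hg : ∀ a b, DifferentiableAt ℝ (fun y => g y a b) x)
    (hX : ∀ a, DifferentiableAt ℝ (fun y => X y a) x)
    (hY : ∀ a, DifferentiableAt ℝ (fun y => Y y a) x) (u : Vec m) :
    fderiv ℝ (fun y => pair (g y) (X y) (Y y)) x u
      = pair (fun a b => fderiv ℝ (fun y => g y a b) x u) (X x) (Y x)
        + pair (g x) (fun a => fderiv ℝ (fun y => X y a) x u) (Y x)
        + pair (g x) (X x) (fun a => fderiv ℝ (fun y => Y y a) x u) := by
  have h := HasFDerivAt.fun_sum (u := univ) fun a _ => HasFDerivAt.fun_sum (u := univ) fun b _ =>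
    (((hg a b).hasFDerivAt.mul (hX a).hasFDerivAt).mul (hY b).hasFDerivAt)
  have h' : fderiv ℝ (fun y => pair (g y) (X y) (Y y)) x = _ := h.fderiv
  rw [h']
  simp only [pair, _root_.sum_apply, ← sum_add_distrib]
  refine sum_congr rfl fun a _ => sum_congr rfl fun b _ => ?_
  simp
  ring

lemma map_eq_sum_single {m : ℕ} (f : Vec m →L[ℝ] ℝ) (u : Vec m) :
    f u = ∑ c, u c * f (Pi.single c 1) := by
  conv_lhs => rw [← Finset.univ_sum_single u]
  rw [map_sum]
  refine sum_congr rfl fun c _ => ?_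
  rw [← smul_eq_mul, ← map_smul, ← Pi.single_smul, smul_eq_mul, mul_one]

/-- The Killing equation contracted with two vectors. -/
lemma killing_pair_eq_zero {m : ℕ} {g : Vec m → Fin m → Fin m → ℝ} {X : Vec m → Vec m}
    {x : Vec m}
    (h : ∀ a b,
      (∑ c, X x c * fderiv ℝ (fun y => g y a b) x (Pi.single c 1))
        + (∑ c, g x c b * fderiv ℝ (fun y => X y c) x (Pi.single a 1))
        + (∑ c, g x a c * fderiv ℝ (fun y => X y c) x (Pi.single b 1)) = 0)
    (u v : Vec m) :
    pair (fun a b => fderiv ℝ (fun y => g y a b) x (X x)) u v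
      + pair (g x) (fun a => fderiv ℝ (fun y => X y a) x u) v
      + pair (g x) u (fun a => fderiv ℝ (fun y => X y a) x v) = 0 := by
  have h1 : pair (fun a b => fderiv ℝ (fun y => g y a b) x (X x)) u v = ∑ a, ∑ b,
      (∑ c, X x c * fderiv ℝ (fun y => g y a b) x (Pi.single c 1)) * u a * v b := by
    unfold pair
    refine sum_congr rfl fun a _ => sum_congr rfl fun b _ => ?_
    rw [← map_eq_sum_single (fderiv ℝ (fun y => g y a b) x) (X x)]
  have h2 : pair (g x) (fun a => fderiv ℝ (fun y => X y a) x u) v = ∑ a, ∑ b,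
      (∑ c, g x c b * fderiv ℝ (fun y => X y c) x (Pi.single a 1)) * u a * v b := by
    unfold pair
    simp only [map_eq_sum_single (fderiv ℝ (fun y => X y _) x) u, mul_sum, sum_mul]
    rw [sum_comm]
    conv_rhs => rw [sum_comm]
    refine sum_congr rfl fun b _ => ?_
    rw [sum_comm]
    exact sum_congr rfl fun a _ => sum_congr rfl fun c _ => by ring
  have h3 : pair (g x) u (fun a => fderiv ℝ (fun y => X y a) x v) = ∑ a, ∑ b,
      (∑ c, g x a c * fderiv ℝ (fun y => X y c) x (Pi.single b 1)) * u a * v b := by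
    unfold pair
    simp only [map_eq_sum_single (fderiv ℝ (fun y => X y _) x) v, mul_sum, sum_mul]
    refine sum_congr rfl fun a _ => ?_
    rw [sum_comm]
    exact sum_congr rfl fun b _ => sum_congr rfl fun c _ => by ring
  rw [h1, h2, h3, ← sum_add_distrib, ← sum_add_distrib]
  refine sum_eq_zero fun a _ => ?_
  rw [← sum_add_distrib, ← sum_add_distrib]
  refine sum_eq_zero fun b _ => ?_
  rw [← add_mul, ← add_mul, ← add_mul, ← add_mul, h, zero_mul, zero_mul]

lemma extd_one_apply {m : ℕ} (ω : FormField m 1) (x : Vec m) (v : Fin 2 → Vec m) :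
    extd ω x v = fderiv ℝ (fun y => ω y fun _ => v 1) x (v 0)
      - fderiv ℝ (fun y => ω y fun _ => v 0) x (v 1) := by
  have h0 : (fun j : Fin 1 => v ((0 : Fin 2).succAbove j)) = fun _ => v 1 := by
    ext j : 1
    rw [Subsingleton.elim j 0]
    rfl
  have h1 : (fun j : Fin 1 => v ((1 : Fin 2).succAbove j)) = fun _ => v 0 := by
    ext j : 1
    rw [Subsingleton.elim j 0]
    rfl
  unfold extd
  rw [Fin.sum_univ_two, h0, h1]
  simp
  ring

lemma extd_zero_apply {m : ℕ} (f : Vec m → ℝ) (x : Vec m) (v : Fin (0 + 1) → Vec m) :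
    extd (fun y (_ : Fin 0 → Vec m) => f y) x v = fderiv ℝ f x (v 0) := by
  simp [extd]

/-- Carter's identity at a point where the Gram determinant of the Killing fields is nonzero. -/
lemma det_mul_extd_eq {m s : ℕ} {g : Vec m → Fin m → Fin m → ℝ} {K : Fin s → Vec m → Vec m}
    {x : Vec m}
    (hg : ∀ a b y, DifferentiableAt ℝ (fun z => g z a b) y)
    (hK : ∀ μ a y, DifferentiableAt ℝ (fun z => K μ z a) y)
    (hgsymm : ∀ y a b, g y a b = g y b a)
    (hKilling : ∀ μ a b,
      (∑ c, K μ x c * fderiv ℝ (fun y => g y a b) x (Pi.single c 1))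
        + (∑ c, g x c b * fderiv ℝ (fun y => K μ y c) x (Pi.single a 1))
        + (∑ c, g x a c * fderiv ℝ (fun y => K μ y c) x (Pi.single b 1)) = 0)
    (hcomm : ∀ μ ν a,
      (∑ b, (K μ x b * fderiv ℝ (fun y => K ν y a) x (Pi.single b 1)
        - K ν x b * fderiv ℝ (fun y => K μ y a) x (Pi.single b 1))) = 0)
    (hint : ∀ μ, ∀ v : Fin (2 + s) → Vec m,
      wedge (extd (k := 1) fun y v => pair (g y) (K μ y) (v 0))
        (fun y (v : Fin s → Vec m) => (Matrix.of fun μ ν => pair (g y) (K μ y) (v ν)).det) x v = 0)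
    (hdet : (Matrix.of fun μ ν => pair (g x) (K μ x) (K ν x)).det ≠ 0)
    (v : Fin (s + 1) → Vec m) :
    (Matrix.of fun μ ν => pair (g x) (K μ x) (K ν x)).det *
      extd (fun y (v : Fin s → Vec m) => (Matrix.of fun μ ν => pair (g y) (K μ y) (v ν)).det) x v
      = ∑ i : Fin (s + 1), (-1 : ℝ) ^ (i : ℕ) *
        (fderiv ℝ (fun y => (Matrix.of fun μ ν => pair (g y) (K μ y) (K ν y)).det) x (v i) *
          (Matrix.of fun μ ν => pair (g x) (K μ x) (v (i.succAbove ν))).det) := by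
  set G : Matrix (Fin s) (Fin s) ℝ := Matrix.of fun μ ν => pair (g x) (K μ x) (K ν x) with hG
  let A : Fin s → Vec m → Vec m → ℝ := fun μ u v => fderiv ℝ (fun y => pair (g y) (K μ y) v) x u
  let dG : Fin s → Fin s → Vec m → ℝ := fun μ ν u =>
    fderiv ℝ (fun y => pair (g y) (K μ y) (K ν y)) x u
  have hA : ∀ μ u v, A μ u v = pair (fun a b => fderiv ℝ (fun y => g y a b) x u) (K μ x) v
        + pair (g x) (fun a => fderiv ℝ (fun y => K μ y a) x u) v := by
    intro μ u v
    have := fderiv_pair_apply (fun a b => hg a b x) (fun a => hK μ a x)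
      (Y := fun _ => v) (fun a => differentiableAt_const _) u
    simp only [A]
    rw [this, add_eq_left]
    simp [pair]
  have hdGA : ∀ μ ν u, dG μ ν u = A μ u (K ν x)
      + pair (g x) (K μ x) (fun a => fderiv ℝ (fun y => K ν y a) x u) := by
    intro μ ν u
    rw [hA]
    exact fderiv_pair_apply (fun a b => hg a b x) (fun a => hK μ a x) (fun a => hK ν a x) u
  have hlie : ∀ μ ν, (fun a => fderiv ℝ (fun y => K μ y a) x (K ν x))
      = fun a => fderiv ℝ (fun y => K ν y a) x (K μ x) := by
    intro μ ν
    ext a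
    have := hcomm ν μ a
    rw [sum_sub_distrib, ← map_eq_sum_single (fderiv ℝ (fun y => K μ y a) x),
      ← map_eq_sum_single (fderiv ℝ (fun y => K ν y a) x)] at this
    exact sub_eq_zero.1 this
  let B : Fin s → Vec m →ₗ[ℝ] Vec m →ₗ[ℝ] ℝ := fun μ => LinearMap.mk₂ ℝ (A μ)
    (fun u u' v => by simp only [A, map_add])
    (fun c u v => by simp only [A, map_smul])
    (fun u v v' => by
      simp only [hA, ← pairₗ_apply, map_add]
      ring)
    (fun c u v => by
      simp only [hA, ← pairₗ_apply, map_smul, smul_add])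
  let θ : Fin s → Vec m →ₗ[ℝ] ℝ := fun μ => pairₗ (g x) (K μ x)
  have hextd : ∀ μ (u : Fin 2 → Vec m),
      extd (k := 1) (fun y v => pair (g y) (K μ y) (v 0)) x u
        = A μ (u 0) (u 1) - A μ (u 1) (u 0) := fun μ u => extd_one_apply _ _ _
  have hanti : ∀ μ u v, (B μ - (B μ).flip) u v = -(B μ - (B μ).flip) v u := by
    intro μ u v
    simp only [LinearMap.sub_apply, LinearMap.flip_apply]
    ring
  have hΩ : ∀ μ ν v, (B μ - (B μ).flip) (K ν x) v = -dG μ ν v := by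
    intro μ ν v
    change A μ (K ν x) v - A μ v (K ν x) = _
    have := killing_pair_eq_zero (hKilling ν) (K μ x) v
    rw [← hlie μ ν] at this
    rw [hdGA, hA μ (K ν x) v]
    linarith
  have hker : ∀ μ u v, (∀ ν, θ ν u = 0) → (∀ ν, θ ν v = 0) → (B μ - (B μ).flip) u v = 0 := by
    intro μ u v hu hv
    have h := mul_eq_zero_of_wedge_eq_zero (v := Fin.append ![u, v] fun ν => K ν x)
      ?_ ?_ ?_ (hint μ (Fin.append ![u, v] fun ν => K ν x))
    · simp only [Fin.append_left, Fin.append_right, hextd] at h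
      exact (mul_eq_zero.1 h).resolve_right hdet
    · intro a w
      simp only [hextd]
      obtain rfl | rfl : a = 1 ∨ a = Equiv.swap 0 1 := by
        revert a
        decide
      · simp
      · simp
    · intro b w
      have := Matrix.det_permute' b (Matrix.of fun μ ν => pair (g x) (K μ x) (w ν))
      exact this
    · rintro w ⟨i, j, hij⟩
      rw [Fin.append_left] at hij
      refine Matrix.det_eq_zero_of_column_eq_zero j fun ν => ?_
      rw [Matrix.of_apply, hij]
      fin_cases i
      · exact hu ν
      · exact hv ν
  have hdGsymm : ∀ μ ν u, dG μ ν u = dG ν μ u := by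
    intro μ ν u
    simp only [dG, pair_symm (hgsymm _) (K μ _) (K ν _)]
  have hstr := det_mul_eq_sum_of_contraction θ (fun ν => K ν x) (fun μ => B μ - (B μ).flip) dG G
    (fun μ ν => rfl) hdet hdGsymm hanti hΩ hker
  have hdiff : ∀ μ (Y : Vec m → Vec m), (∀ a, DifferentiableAt ℝ (fun y => Y y a) x) →
      DifferentiableAt ℝ (fun y => pair (g y) (K μ y) (Y y)) x := fun μ Y hY =>
    DifferentiableAt.fun_sum fun a _ => DifferentiableAt.fun_sum fun b _ =>
      ((hg a b x).mul (hK μ a x)).mul (hY b)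
  have hmain := det_mul_sum_det_updateRow θ A dG G hstr v
  convert hmain using 1
  · congr 1
    refine sum_congr rfl fun i _ => ?_
    congr 1
    exact fderiv_det_apply _ x (v i) fun μ ν => hdiff μ _ fun a => differentiableAt_const _
  · refine sum_congr rfl fun i _ => ?_
    congr 2
    refine (fderiv_det_apply (fun y => Matrix.of fun μ ν => pair (g y) (K μ y) (K ν y)) x (v i)
      fun μ ν => hdiff μ _ fun a => hK ν a x).trans (sum_congr rfl fun μ _ => ?_)
    rw [← hG, ← Matrix.cramer_transpose_apply, Matrix.cramer_eq_adjugate_mulVec,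
      ← Matrix.adjugate_transpose]
    simp only [Matrix.mulVec, dotProduct, Matrix.transpose_apply]
    rfl

/-- **Carter's identity.** For commuting Killing vector fields
`K₀, …, K_{s-1}` of a Lorentzian metric `g` satisfying the orthogonal integrability
condition `dK_μ ∧ K₀ ∧ … ∧ K_{s-1} = 0`, the `s`-form `w = K₀^♭ ∧ … ∧ K_{s-1}^♭`
and the area function `W = -det(g(K_μ,K_ν))` satisfy `w ∧ dW = (-1)^s W dw`. -/
theorem stmt_4 (n s : ℕ) (hs : 1 ≤ s) (hsn : s ≤ n)
    (g ginv : Vec (n + 1) → Fin (n + 1) → Fin (n + 1) → ℝ)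
    (K : Fin s → Vec (n + 1) → Vec (n + 1))
    (hgsm : ∀ a b, ContDiff ℝ (⊤ : ℕ∞) fun x => g x a b)
    (hKsm : ∀ μ a, ContDiff ℝ (⊤ : ℕ∞) fun x => K μ x a)
    (hgsymm : ∀ x a b, g x a b = g x b a)
    (hginv : ∀ x a b, (∑ c, ginv x a c * g x c b) = if a = b then (1 : ℝ) else 0)
    -- Killing equations: `L_{K_μ} g = 0`
    (hKilling : ∀ μ x a b,
      (∑ c, K μ x c * fderiv ℝ (fun y => g y a b) x (Pi.single c 1))
        + (∑ c, g x c b * fderiv ℝ (fun y => K μ y c) x (Pi.single a 1))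
        + (∑ c, g x a c * fderiv ℝ (fun y => K μ y c) x (Pi.single b 1)) = 0)
    -- the Killing fields commute: `[K_μ, K_ν] = 0`
    (hcomm : ∀ μ ν x a,
      (∑ b, (K μ x b * fderiv ℝ (fun y => K ν y a) x (Pi.single b 1)
        - K ν x b * fderiv ℝ (fun y => K μ y a) x (Pi.single b 1))) = 0)
    -- the lowered one-forms `K_μ^♭`
    (Kb : Fin s → FormField (n + 1) 1)
    (hKb : Kb = fun μ x v => ∑ a, ∑ b, g x a b * K μ x a * (v 0) b)
    -- `w = K₀^♭ ∧ … ∧ K_{s-1}^♭`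
    (w : FormField (n + 1) s)
    (hw : w = fun x v => Matrix.det (Matrix.of fun μ ν : Fin s =>
        ∑ a, ∑ b, g x a b * K μ x a * (v ν) b))
    -- the area function `W`
    (W : Vec (n + 1) → ℝ)
    (hW : W = fun x => -Matrix.det (Matrix.of fun μ ν : Fin s =>
        ∑ a, ∑ b, g x a b * K μ x a * K ν x b))
    -- orthogonal integrability: `dK_μ ∧ K₀ ∧ … ∧ K_{s-1} = 0`
    (hint : ∀ μ, ∀ x, ∀ v : Fin (2 + s) → Vec (n + 1),
      wedge (extd (Kb μ)) w x v = 0) :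
    ∀ x, ∀ v : Fin (s + 1) → Vec (n + 1),
      wedge w (extd (fun y (_ : Fin 0 → Vec (n + 1)) => W y)) x v
        = (-1 : ℝ) ^ s * (W x * extd w x v) := by
  have hg : ∀ a b y, DifferentiableAt ℝ (fun z => g z a b) y := fun a b y =>
    (hgsm a b).differentiable (by simp) y
  have hK : ∀ μ a y, DifferentiableAt ℝ (fun z => K μ z a) y := fun μ a y =>
    (hKsm μ a).differentiable (by simp) y
  subst hKb hw hW
  intro x v
  have hpair : ∀ μ (Y : Vec (n + 1) → Vec (n + 1)), (∀ a, ContDiff ℝ (⊤ : ℕ∞) fun y => Y y a) →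
      ContDiff ℝ (⊤ : ℕ∞) fun y => pair (g y) (K μ y) (Y y) := fun μ Y hY =>
    ContDiff.sum fun a _ => ContDiff.sum fun b _ => ((hgsm a b).mul (hKsm μ a)).mul (hY b)
  have hdetsm : ∀ Y : Fin s → Vec (n + 1) → Vec (n + 1),
      (∀ ν a, ContDiff ℝ (⊤ : ℕ∞) fun y => Y ν y a) →
      ContDiff ℝ (⊤ : ℕ∞) fun y => (Matrix.of fun μ ν => pair (g y) (K μ y) (Y ν y)).det := by
    intro Y hY
    simp only [Matrix.det_apply']
    exact ContDiff.sum fun σ _ => contDiff_const.mul <| contDiff_prod fun μ _ =>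
      hpair _ _ (hY _)
  have hlhs : ∀ y, wedge (l := 0 + 1)
      (fun y (v : Fin s → Vec (n + 1)) => (Matrix.of fun μ ν => pair (g y) (K μ y) (v ν)).det)
      (extd fun y (_ : Fin 0 → Vec (n + 1)) =>
        -(Matrix.of fun μ ν => pair (g y) (K μ y) (K ν y)).det) y v
      = (-1) ^ s * -∑ i : Fin (s + 1), (-1 : ℝ) ^ (i : ℕ) *
        (fderiv ℝ (fun y => (Matrix.of fun μ ν => pair (g y) (K μ y) (K ν y)).det) y (v i) *
          (Matrix.of fun μ ν => pair (g y) (K μ y) (v (i.succAbove ν))).det) := by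
    intro y
    unfold wedge
    simp only [extd_zero_apply, fderiv_fun_neg, _root_.neg_apply]
    refine (sum_perm_sign_mul_det s (Matrix.of fun μ j => pair (g y) (K μ y) (v j)) fun j =>
      -fderiv ℝ (fun y => (Matrix.of fun μ ν => pair (g y) (K μ y) (K ν y)).det) y (v j)).trans ?_
    simp only [neg_mul, mul_neg, sum_neg_distrib]
    rfl
  refine (hlhs x).trans (congrArg _ ?_)
  change _ = -(Matrix.of fun μ ν => pair (g x) (K μ x) (K ν x)).det * extd (fun y
    (v : Fin s → Vec (n + 1)) => (Matrix.of fun μ ν => pair (g y) (K μ y) (v ν)).det) x v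
  rw [neg_mul, neg_inj, eq_comm]
  set D : Vec (n + 1) → ℝ := fun y => (Matrix.of fun μ ν => pair (g y) (K μ y) (K ν y)).det with hD
  have hDsm : ContDiff ℝ (⊤ : ℕ∞) D := hdetsm K hKsm
  have hne : ∀ y, D y ≠ 0 → _ := fun y hy => det_mul_extd_eq (x := y) hg hK hgsymm
    (fun μ => hKilling μ y) (fun μ ν => hcomm μ ν y) (fun μ => hint μ y) hy v
  have hcont : ∀ {f : Vec (n + 1) → ℝ}, ContDiff ℝ (⊤ : ℕ∞) f → ∀ u,
      Continuous fun y => fderiv ℝ f y u := fun hf u =>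
    (hf.continuous_fderiv (by simp)).clm_apply continuous_const
  have hwsm : ∀ u : Fin s → Vec (n + 1), ContDiff ℝ (⊤ : ℕ∞)
      fun y => (Matrix.of fun μ ν => pair (g y) (K μ y) (u ν)).det := fun u =>
    hdetsm (fun ν _ => u ν) fun ν a => contDiff_const
  by_cases hx : x ∈ closure {y | D y ≠ 0}
  · refine closure_minimal (t := {y | _ = _}) hne (isClosed_eq ?_ ?_) hx
    · exact hDsm.continuous.mul (continuous_finsetSum _ fun i _ =>
        continuous_const.mul (hcont (hwsm _) _))
    · exact continuous_finsetSum _ fun i _ => continuous_const.mul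
        ((hcont hDsm _).mul (hwsm _).continuous)
  · have hev : D =ᶠ[nhds x] fun _ => 0 := by
      filter_upwards [isClosed_closure.isOpen_compl.mem_nhds hx] with y hy
      by_contra h
      exact hy (subset_closure h)
    have h0 : (Matrix.of fun μ ν => pair (g x) (K μ x) (K ν x)).det = 0 := hev.eq_of_nhds
    rw [h0, hev.fderiv_eq]
    simp

end
end

section
/- Let γ: ℝ → ℝ be smooth and even with γ(0) = 0, γ(x) = a₂x² + O(x⁴). Under the map ζ = x + iy ↦ w = -iζ², the curve x ↦ x + iγ(x) (x ≥ 0) is mapped to a curve which, parameterized by t = -(x² - a₂²x⁴ + O(x⁶)) < 0, equals it + 2a₂|t|^{3/2} + O(|t|^{5/2}); in particular the image curve together with the image of the half-axis {iy : y ≥ 0} (which maps to itself) forms a C^{1,1/2} boundary curve near the origin. -/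
open Complex

/-- A smooth even function vanishing at `0` is `O(x ^ 2)`, and its derivative is `O(x)`. -/
lemma exists_even_jet_bounds {γ : ℝ → ℝ} (hsmooth : ContDiff ℝ (⊤ : ℕ∞) γ)
    (heven : ∀ x : ℝ, γ (-x) = γ x) (h0 : γ 0 = 0) :
    ∃ (γ₁ γ₂ : ℝ → ℝ) (A : ℝ), 1 ≤ A ∧ (∀ x, HasDerivAt γ (γ₁ x) x) ∧
      (∀ x, HasDerivAt γ₁ (γ₂ x) x) ∧
      ∀ x ∈ Set.Icc (0 : ℝ) 1, |γ₂ x| ≤ A ∧ |γ₁ x| ≤ A * x ∧ |γ x| ≤ A * x ^ 2 := by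
  have hs1 : ContDiff ℝ (⊤ : ℕ∞) (deriv γ) := ContDiff.deriv' (by simpa using hsmooth)
  have hs2 : ContDiff ℝ (⊤ : ℕ∞) (deriv (deriv γ)) := ContDiff.deriv' (by simpa using hs1)
  have hd : ∀ x, HasDerivAt γ (deriv γ x) x := fun x =>
    (hsmooth.differentiable (by simp) x).hasDerivAt
  have hd1 : ∀ x, HasDerivAt (deriv γ) (deriv (deriv γ) x) x := fun x =>
    (hs1.differentiable (by simp) x).hasDerivAt
  have hz : deriv γ 0 = 0 := by
    have h1 : HasDerivAt (fun x => γ (-x)) (-deriv γ 0) 0 := by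
      have h2 : HasDerivAt γ (deriv γ 0) (-0) := by simpa using hd 0
      exact (h2.scomp (0 : ℝ) (hasDerivAt_neg (0 : ℝ))).congr_deriv (by simp)
    have h3 := h1.unique (by simpa only [heven] using hd 0)
    linarith
  obtain ⟨B, hB⟩ := (isCompact_Icc (a := (0 : ℝ)) (b := 1)).exists_bound_of_continuousOn
    hs2.continuous.continuousOn
  have hA : ∀ x ∈ Set.Icc (0 : ℝ) 1, |deriv (deriv γ) x| ≤ max B 1 := fun x hx =>
    (hB x hx).trans (le_max_left _ _)
  have hA1 : ∀ x ∈ Set.Icc (0 : ℝ) 1, |deriv γ x| ≤ max B 1 * x := by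
    intro x hx
    have := (convex_Icc (0 : ℝ) 1).norm_image_sub_le_of_norm_hasDerivWithin_le
      (fun y _ => (hd1 y).hasDerivWithinAt) hA (by simp : (0 : ℝ) ∈ Set.Icc (0 : ℝ) 1) hx
    simpa [hz, abs_of_nonneg hx.1] using this
  refine ⟨deriv γ, deriv (deriv γ), max B 1, le_max_right _ _, hd, hd1, fun x hx =>
    ⟨hA x hx, hA1 x hx, ?_⟩⟩
  have := (convex_Icc (0 : ℝ) x).norm_image_sub_le_of_norm_hasDerivWithin_le
    (C := max B 1 * x)
    (fun y _ => (hd y).hasDerivWithinAt)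
    (fun y hy => (hA1 y ⟨hy.1, hy.2.trans hx.2⟩).trans
      (mul_le_mul_of_nonneg_left hy.2 (by positivity)))
    (Set.left_mem_Icc.2 hx.1) (Set.right_mem_Icc.2 hx.1)
  rw [h0, sub_zero, sub_zero, Real.norm_eq_abs, Real.norm_eq_abs, abs_of_nonneg hx.1] at this
  linarith

lemma abs_mul_deriv_le {A x c c₁ : ℝ} (hA : 1 ≤ A) (hx : x ∈ Set.Icc (0 : ℝ) (1 / (2 * A)))
    (h1 : |c₁| ≤ A * x) (h : |c| ≤ A * x ^ 2) : |c * c₁| ≤ x / 4 := by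
  have hAx : A * x ≤ 1 / 2 := by
    have := mul_le_mul_of_nonneg_left hx.2 (by linarith : (0 : ℝ) ≤ A)
    have e : A * (1 / (2 * A)) = 1 / 2 := by field_simp
    linarith
  have hx0 := hx.1
  have hAx0 : 0 ≤ A * x := by positivity
  rw [abs_mul]
  calc |c| * |c₁| ≤ (A * x ^ 2) * (A * x) := by gcongr
    _ = (A * x) * (A * x) * x := by ring
    _ ≤ (1 / 2) * (1 / 2) * x := by gcongr
    _ = x / 4 := by ring

/-- The squared difference of parameters is controlled by the difference of heights. -/
lemma sq_sub_le_of_jet_bounds {γ γ₁ : ℝ → ℝ} {A : ℝ}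
    (hd : ∀ x, HasDerivAt γ (γ₁ x) x)
    (hb : ∀ x ∈ Set.Icc (0 : ℝ) (1 / (2 * A)), |γ x * γ₁ x| ≤ x / 4)
    {x y : ℝ} (hx : x ∈ Set.Icc (0 : ℝ) (1 / (2 * A)))
    (hy : y ∈ Set.Icc (0 : ℝ) (1 / (2 * A))) :
    (x - y) ^ 2 ≤ 2 * |(x ^ 2 - γ x ^ 2) - (y ^ 2 - γ y ^ 2)| := by
  have hder : ∀ z, HasDerivAt (fun z => z ^ 2 / 2 - γ z ^ 2) (z - 2 * (γ z * γ₁ z)) z := by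
    intro z
    exact (((hasDerivAt_id z).pow 2 |>.div_const 2).sub ((hd z).pow 2)).congr_deriv
      (by simp; ring)
  have hmono : MonotoneOn (fun z => z ^ 2 / 2 - γ z ^ 2) (Set.Icc (0 : ℝ) (1 / (2 * A))) := by
    refine monotoneOn_of_deriv_nonneg (convex_Icc _ _)
      (fun z _ => (hder z).continuousAt.continuousWithinAt)
      (fun z _ => (hder z).differentiableAt.differentiableWithinAt) (fun z hz => ?_)
    have hz' := interior_subset hz
    rw [(hder z).deriv]
    have := (abs_le.1 (hb z hz')).2
    linarith [hz'.1]
  wlog hxy : y ≤ x generalizing x y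
  · have := this hy hx (le_of_not_ge hxy)
    rw [abs_sub_comm]
    linarith [sq_nonneg (x - y)]
  have := hmono hy hx hxy
  simp only at this
  have h2 := le_abs_self ((x ^ 2 - γ x ^ 2) - (y ^ 2 - γ y ^ 2))
  nlinarith [hx.1, hy.1, mul_nonneg hy.1 (sub_nonneg.2 hxy)]

/-- The slope of the straightened curve is Lipschitz in the original parameter. -/
lemma slope_lipschitz {γ γ₁ γ₂ : ℝ → ℝ} {A : ℝ} (hA : 1 ≤ A)
    (h0 : γ 0 = 0)
    (hd : ∀ x, HasDerivAt γ (γ₁ x) x) (hd1 : ∀ x, HasDerivAt γ₁ (γ₂ x) x)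
    (hj : ∀ x ∈ Set.Icc (0 : ℝ) (1 / (2 * A)),
      |γ₂ x| ≤ A ∧ |γ₁ x| ≤ A * x ∧ |γ x| ≤ A * x ^ 2)
    (hb : ∀ x ∈ Set.Icc (0 : ℝ) (1 / (2 * A)), |γ x * γ₁ x| ≤ x / 4) :
    ∃ L > 0, ∀ x ∈ Set.Icc (0 : ℝ) (1 / (2 * A)), ∀ y ∈ Set.Icc (0 : ℝ) (1 / (2 * A)),
      |(γ x + x * γ₁ x) / (x - γ x * γ₁ x) - (γ y + y * γ₁ y) / (y - γ y * γ₁ y)|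
        ≤ L * |x - y| := by
  have hden : ∀ x ∈ Set.Icc (0 : ℝ) (1 / (2 * A)), x / 2 ≤ x - γ x * γ₁ x ∧
      x - γ x * γ₁ x ≤ 2 * x := fun x hx => by
    have := abs_le.1 (hb x hx)
    constructor <;> linarith [hx.1]
  have hnum : ∀ x ∈ Set.Icc (0 : ℝ) (1 / (2 * A)), |γ x + x * γ₁ x| ≤ 2 * A * x ^ 2 := by
    intro x hx
    obtain ⟨-, h1, h⟩ := hj x hx
    calc _ ≤ |γ x| + |x * γ₁ x| := abs_add_le _ _
      _ = |γ x| + x * |γ₁ x| := by rw [abs_mul, abs_of_nonneg hx.1]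
      _ ≤ A * x ^ 2 + x * (A * x) := by have := hx.1; gcongr
      _ = _ := by ring
  have hx1 : 1 / (2 * A) ≤ 1 := by
    rw [div_le_one (by linarith)]; linarith
  set q : ℝ → ℝ := fun x => (γ x + x * γ₁ x) / (x - γ x * γ₁ x) with hq
  set L : ℝ := 4 * (6 * A + 2 * A * (1 + 2 * A ^ 2)) with hL
  have hq0 : q 0 = 0 := by simp [hq, h0]
  have hLpos : 4 * A ≤ L := by rw [hL]; nlinarith [pow_pos (by linarith : 0 < A) 3]
  have hzero : ∀ x ∈ Set.Icc (0 : ℝ) (1 / (2 * A)), |q x - q 0| ≤ L * |x - 0| := by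
    intro x hx
    rw [hq0, sub_zero, sub_zero, abs_of_nonneg hx.1]
    rcases hx.1.eq_or_lt with h | h
    · rw [← h, hq0]; simp
    · have h1 := (hden x hx).1
      have hp : 0 < x - γ x * γ₁ x := by linarith
      simp only [hq]
      rw [abs_div, abs_of_pos hp, div_le_iff₀ hp]
      calc _ ≤ 2 * A * x ^ 2 := hnum x hx
        _ = 4 * A * x * (x / 2) := by ring
        _ ≤ L * x * (x - γ x * γ₁ x) := by gcongr
  have hder : ∀ x ∈ Set.Ioc (0 : ℝ) (1 / (2 * A)), HasDerivWithinAt q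
      (((γ₁ x + (γ₁ x + x * γ₂ x)) * (x - γ x * γ₁ x) -
        (γ x + x * γ₁ x) * (1 - (γ₁ x * γ₁ x + γ x * γ₂ x))) / (x - γ x * γ₁ x) ^ 2)
        (Set.Ioc (0 : ℝ) (1 / (2 * A))) x := by
    intro x hx
    have hp : x - γ x * γ₁ x ≠ 0 := by
      have := (hden x ⟨hx.1.le, hx.2⟩).1
      have := hx.1
      linarith
    have hn := (hd x).add ((hasDerivAt_id x).mul (hd1 x))
    have hm := (hasDerivAt_id x).sub ((hd x).mul (hd1 x))
    have := (hn.div hm hp).hasDerivWithinAt (s := Set.Ioc (0 : ℝ) (1 / (2 * A)))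
    exact this.congr_deriv (by simp)
  have hbd : ∀ x ∈ Set.Ioc (0 : ℝ) (1 / (2 * A)),
      ‖((γ₁ x + (γ₁ x + x * γ₂ x)) * (x - γ x * γ₁ x) -
        (γ x + x * γ₁ x) * (1 - (γ₁ x * γ₁ x + γ x * γ₂ x))) / (x - γ x * γ₁ x) ^ 2‖ ≤ L := by
    intro x hx
    have hx' : x ∈ Set.Icc (0 : ℝ) (1 / (2 * A)) := ⟨hx.1.le, hx.2⟩
    obtain ⟨h2, h1, h⟩ := hj x hx'
    obtain ⟨hl, hu⟩ := hden x hx'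
    have hx0 := hx.1
    have hp : 0 < x - γ x * γ₁ x := by linarith
    have hxle : x ≤ 1 := hx.2.trans hx1
    rw [norm_div, norm_pow, Real.norm_eq_abs, Real.norm_eq_abs, abs_of_pos hp,
      div_le_iff₀ (by positivity)]
    have b1 : |γ₁ x + (γ₁ x + x * γ₂ x)| ≤ 3 * A * x := by
      calc _ ≤ |γ₁ x| + (|γ₁ x| + |x * γ₂ x|) :=
            (abs_add_le _ _).trans (by gcongr; exact abs_add_le _ _)
        _ = |γ₁ x| + (|γ₁ x| + x * |γ₂ x|) := by rw [abs_mul, abs_of_pos hx0]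
        _ ≤ A * x + (A * x + x * A) := by gcongr
        _ = _ := by ring
    have b2 : |1 - (γ₁ x * γ₁ x + γ x * γ₂ x)| ≤ 1 + 2 * A ^ 2 := by
      calc _ ≤ |(1 : ℝ)| + (|γ₁ x * γ₁ x| + |γ x * γ₂ x|) :=
            (abs_sub _ _).trans (by gcongr; exact abs_add_le _ _)
        _ = 1 + (|γ₁ x| * |γ₁ x| + |γ x| * |γ₂ x|) := by rw [abs_mul, abs_mul, abs_one]
        _ ≤ 1 + ((A * 1) * (A * 1) + (A * 1 ^ 2) * A) := by
            have h1' : |γ₁ x| ≤ A * 1 := h1.trans (by gcongr)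
            have h' : |γ x| ≤ A * 1 ^ 2 := h.trans (by gcongr)
            gcongr
        _ = _ := by ring
    calc _ ≤ |(γ₁ x + (γ₁ x + x * γ₂ x)) * (x - γ x * γ₁ x)| +
          |(γ x + x * γ₁ x) * (1 - (γ₁ x * γ₁ x + γ x * γ₂ x))| := abs_sub _ _
      _ = |γ₁ x + (γ₁ x + x * γ₂ x)| * (x - γ x * γ₁ x) +
          |γ x + x * γ₁ x| * |1 - (γ₁ x * γ₁ x + γ x * γ₂ x)| := by
            rw [abs_mul, abs_mul, abs_of_pos hp]
      _ ≤ (3 * A * x) * (2 * x) + (2 * A * x ^ 2) * (1 + 2 * A ^ 2) := by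
            have := hnum x hx'
            gcongr
      _ = L * (x / 2) ^ 2 := by rw [hL]; ring
      _ ≤ _ := by
            have : 0 ≤ L := by linarith
            gcongr
  refine ⟨L, by linarith, fun x hx y hy => ?_⟩
  rcases hx.1.eq_or_lt with h | h
  · have := hzero y hy
    rw [← h, abs_sub_comm, abs_sub_comm 0 y]
    exact this
  rcases hy.1.eq_or_lt with h' | h'
  · rw [← h']
    exact hzero x hx
  exact (convex_Ioc _ _).norm_image_sub_le_of_norm_hasDerivWithin_le hder hbd ⟨h', hy.2⟩ ⟨h, hx.2⟩

lemma abs_sub_rpow_three_halves_le {a₂ A C x c : ℝ} (hx : 0 ≤ x) (hC : 0 ≤ C)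
    (hA : |c| ≤ A * x ^ 2) (hT : |c - a₂ * x ^ 2| ≤ C * x ^ 4)
    (hτ : x ^ 2 ≤ 2 * (x ^ 2 - c ^ 2)) :
    |2 * x * c - 2 * a₂ * |x ^ 2 - c ^ 2| ^ ((3 : ℝ) / 2)|
      ≤ 32 * (2 * C + 6 * |a₂| * A ^ 2) * |x ^ 2 - c ^ 2| ^ ((5 : ℝ) / 2) := by
  have hτ0 : 0 ≤ x ^ 2 - c ^ 2 := by nlinarith [sq_nonneg x]
  rw [abs_of_nonneg hτ0]
  set r := √(x ^ 2 - c ^ 2) with hr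
  have hr0 : 0 ≤ r := Real.sqrt_nonneg _
  have hr2 : r ^ 2 = x ^ 2 - c ^ 2 := Real.sq_sqrt hτ0
  have e3 : (x ^ 2 - c ^ 2) ^ ((3 : ℝ) / 2) = r ^ 3 := by
    rw [hr, Real.sqrt_eq_rpow, ← Real.rpow_mul_natCast hτ0]; norm_num
  have e5 : (x ^ 2 - c ^ 2) ^ ((5 : ℝ) / 2) = r ^ 5 := by
    rw [hr, Real.sqrt_eq_rpow, ← Real.rpow_mul_natCast hτ0]; norm_num
  rw [e3, e5]
  have hrx : r ≤ x := abs_le_of_sq_le_sq' (by nlinarith [sq_nonneg c]) hx |>.2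
  have hxr : x ≤ 2 * r := abs_le_of_sq_le_sq' (by nlinarith [sq_nonneg r]) (by linarith) |>.2
  have hc2 : c ^ 2 ≤ A ^ 2 * x ^ 4 := by
    calc c ^ 2 = |c| ^ 2 := (sq_abs c).symm
      _ ≤ (A * x ^ 2) ^ 2 := by gcongr
      _ = _ := by ring
  have h3 : x ^ 3 - r ^ 3 ≤ 3 * A ^ 2 * x ^ 5 := by
    have h4 : x * (x - r) ≤ A ^ 2 * x ^ 4 := by
      nlinarith [mul_nonneg hr0 (sub_nonneg.2 hrx)]
    calc x ^ 3 - r ^ 3 = (x - r) * (x ^ 2 + x * r + r ^ 2) := by ring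
      _ ≤ (x - r) * (x ^ 2 + x * x + x ^ 2) := by
          have := sub_nonneg.2 hrx
          gcongr
      _ = 3 * x * (x * (x - r)) := by ring
      _ ≤ 3 * x * (A ^ 2 * x ^ 4) := by gcongr
      _ = _ := by ring
  have h3' : 0 ≤ x ^ 3 - r ^ 3 := sub_nonneg.2 (by gcongr)
  calc |2 * x * c - 2 * a₂ * r ^ 3|
      = |2 * x * (c - a₂ * x ^ 2) + 2 * a₂ * (x ^ 3 - r ^ 3)| := by ring_nf
    _ ≤ |2 * x * (c - a₂ * x ^ 2)| + |2 * a₂ * (x ^ 3 - r ^ 3)| := abs_add_le _ _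
    _ = 2 * x * |c - a₂ * x ^ 2| + 2 * |a₂| * (x ^ 3 - r ^ 3) := by
        rw [abs_mul, abs_mul, abs_mul, abs_mul, abs_of_nonneg hx, abs_of_nonneg h3', abs_two]
    _ ≤ 2 * x * (C * x ^ 4) + 2 * |a₂| * (3 * A ^ 2 * x ^ 5) := by gcongr
    _ = (2 * C + 6 * |a₂| * A ^ 2) * x ^ 5 := by ring
    _ ≤ (2 * C + 6 * |a₂| * A ^ 2) * (2 * r) ^ 5 := by gcongr
    _ = _ := by ring

/-- The image of the curve is the graph of a `C^{1,1/2}` function extended by zero. -/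
lemma exists_graph_function {γ γ₁ γ₂ : ℝ → ℝ} {A : ℝ} (hA : 1 ≤ A)
    (h0 : γ 0 = 0)
    (hd : ∀ x, HasDerivAt γ (γ₁ x) x) (hd1 : ∀ x, HasDerivAt γ₁ (γ₂ x) x)
    (hj : ∀ x ∈ Set.Icc (0 : ℝ) (1 / (2 * A)),
      |γ₂ x| ≤ A ∧ |γ₁ x| ≤ A * x ∧ |γ x| ≤ A * x ^ 2) :
    ∃ δ > (0 : ℝ), ∃ μ : ℝ → ℝ,
        (∀ t : ℝ, 0 ≤ t → μ t = 0) ∧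
        (∀ x : ℝ, 0 ≤ x → x ≤ δ → μ (-(x ^ 2 - (γ x) ^ 2)) = 2 * x * γ x) ∧
        DifferentiableOn ℝ μ (Set.Ioo (-δ) δ) ∧
        ∃ Ch > (0 : ℝ), ∀ s ∈ Set.Ioo (-δ) δ, ∀ t ∈ Set.Ioo (-δ) δ,
          |deriv μ s - deriv μ t| ≤ Ch * |s - t| ^ ((1 : ℝ) / 2) := by
  have hb : ∀ x ∈ Set.Icc (0 : ℝ) (1 / (2 * A)), |γ x * γ₁ x| ≤ x / 4 := fun x hx =>
    abs_mul_deriv_le hA hx (hj x hx).2.1 (hj x hx).2.2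
  obtain ⟨L, hL, hLip⟩ := slope_lipschitz hA h0 hd hd1 hj hb
  have hsq := fun {x y : ℝ} => sq_sub_le_of_jet_bounds (x := x) (y := y) hd hb
  set b : ℝ := 1 / (2 * A) with hbdef
  have hb0 : 0 < b := by positivity
  have hb1 : b ≤ 1 / 2 := by
    rw [hbdef, div_le_div_iff₀ (by positivity) (by positivity)]; linarith
  set τ : ℝ → ℝ := fun x => x ^ 2 - γ x ^ 2 with hτ
  have hτ0 : τ 0 = 0 := by simp [hτ, h0]
  have hτd : ∀ x, HasDerivAt τ (2 * (x - γ x * γ₁ x)) x := by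
    intro x
    exact (((hasDerivAt_id x).pow 2).sub ((hd x).pow 2)).congr_deriv (by simp; ring)
  have hτc : Continuous τ := continuous_iff_continuousAt.2 fun x => (hτd x).continuousAt
  have hτmono : MonotoneOn τ (Set.Icc 0 b) := by
    refine monotoneOn_of_deriv_nonneg (convex_Icc _ _) hτc.continuousOn
      (fun z _ => (hτd z).differentiableAt.differentiableWithinAt) (fun z hz => ?_)
    have hz' := interior_subset hz
    rw [(hτd z).deriv]
    have := (abs_le.1 (hb z hz')).2
    linarith [hz'.1]
  have h0mem : (0 : ℝ) ∈ Set.Icc 0 b := ⟨le_rfl, hb0.le⟩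
  have hbmem : b ∈ Set.Icc 0 b := ⟨hb0.le, le_rfl⟩
  have hτb : b ^ 2 / 2 ≤ τ b := by
    have h1 := hsq hbmem h0mem
    have h2 : 0 ≤ τ b := by simpa [hτ0] using hτmono h0mem hbmem hb0.le
    change (b - 0) ^ 2 ≤ 2 * |τ b - τ 0| at h1
    rw [hτ0, sub_zero, sub_zero, abs_of_nonneg h2] at h1
    linarith
  have hex : ∀ u : ℝ, ∃ x : ℝ, u ∈ Set.Icc 0 (τ b) → x ∈ Set.Icc 0 b ∧ τ x = u := by
    intro u
    by_cases hu : u ∈ Set.Icc 0 (τ b)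
    · obtain ⟨x, hx, hxu⟩ := intermediate_value_Icc hb0.le hτc.continuousOn
        (by rwa [hτ0] : u ∈ Set.Icc (τ 0) (τ b))
      exact ⟨x, fun _ => ⟨hx, hxu⟩⟩
    · exact ⟨0, fun h => absurd h hu⟩
  choose X hX using hex
  have hXτ : ∀ x ∈ Set.Icc 0 b, X (τ x) = x := by
    intro x hx
    have hm : τ x ∈ Set.Icc 0 (τ b) :=
      ⟨by simpa [hτ0] using hτmono h0mem hx hx.1, hτmono hx hbmem hx.2⟩
    obtain ⟨h1, h2⟩ := hX _ hm
    have h3 := hsq h1 hx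
    change _ ≤ 2 * |τ (X (τ x)) - τ x| at h3
    rw [h2, sub_self, abs_zero, mul_zero] at h3
    exact sub_eq_zero.1 (pow_eq_zero_iff two_ne_zero |>.1 (le_antisymm h3 (sq_nonneg _)))
  have hX0 : X 0 = 0 := by simpa [hτ0] using hXτ 0 h0mem
  set δ : ℝ := b ^ 2 / 2 with hδ
  have hδ0 : 0 < δ := by positivity
  have hδb : δ ≤ b := by rw [hδ]; nlinarith
  set Y : ℝ → ℝ := fun t => X (max (-t) 0) with hY
  have hmax : ∀ t ∈ Set.Ioo (-δ) δ, max (-t) 0 ∈ Set.Icc 0 (τ b) := fun t ht =>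
    ⟨le_max_right _ _, max_le (by linarith [ht.1]) (by linarith)⟩
  have hYm : ∀ t ∈ Set.Ioo (-δ) δ, Y t ∈ Set.Icc 0 b := fun t ht => (hX _ (hmax t ht)).1
  have hYτ : ∀ t ∈ Set.Ioo (-δ) δ, τ (Y t) = max (-t) 0 := fun t ht => (hX _ (hmax t ht)).2
  have hY0 : ∀ t, 0 ≤ t → Y t = 0 := fun t ht => by
    simp only [hY]; rw [max_eq_right (by linarith), hX0]
  have hYsq : ∀ s ∈ Set.Ioo (-δ) δ, ∀ t ∈ Set.Ioo (-δ) δ, (Y s - Y t) ^ 2 ≤ 2 * |s - t| := by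
    intro s hs t ht
    have h1 := hsq (hYm s hs) (hYm t ht)
    change _ ≤ 2 * |τ (Y s) - τ (Y t)| at h1
    rw [hYτ s hs, hYτ t ht] at h1
    have h2 := abs_max_sub_max_le_abs (-s) (-t) 0
    rw [show -s - -t = -(s - t) by ring, abs_neg] at h2
    linarith
  have hYh : ∀ s ∈ Set.Ioo (-δ) δ, ∀ t ∈ Set.Ioo (-δ) δ, |Y s - Y t| ≤ √(2 * |s - t|) :=
    fun s hs t ht => Real.abs_le_sqrt (hYsq s hs t ht)
  have hYc : ∀ t ∈ Set.Ioo (-δ) δ, ContinuousAt Y t := by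
    intro t ht
    rw [ContinuousAt, tendsto_iff_norm_sub_tendsto_zero]
    have hlim : Filter.Tendsto (fun s => √(2 * |s - t|)) (nhds t) (nhds 0) := by
      have : Continuous fun s : ℝ => √(2 * |s - t|) := by fun_prop
      simpa using this.tendsto t
    refine squeeze_zero' (Filter.Eventually.of_forall fun _ => norm_nonneg _) ?_ hlim
    filter_upwards [isOpen_Ioo.mem_nhds ht] with s hs using hYh s hs t ht
  have hG : ∀ x, HasDerivAt (fun x => 2 * x * γ x) (2 * (γ x + x * γ₁ x)) x := by
    intro x
    exact (((hasDerivAt_id x).const_mul 2).mul (hd x)).congr_deriv (by simp; ring)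
  set q : ℝ → ℝ := fun x => (γ x + x * γ₁ x) / (x - γ x * γ₁ x) with hq
  have hq0 : q 0 = 0 := by simp [hq, h0]
  have hder : ∀ t ∈ Set.Ioo (-δ) δ,
      HasDerivAt (fun t => 2 * Y t * γ (Y t)) (-q (Y t)) t := by
    intro t ht
    rcases lt_trichotomy t 0 with h | h | h
    · have hYpos : 0 < Y t := by
        refine (hYm t ht).1.lt_of_ne fun h' => ?_
        have := hYτ t ht
        rw [← h', hτ0, max_eq_left (by linarith)] at this
        linarith
      have hden : 0 < Y t - γ (Y t) * γ₁ (Y t) := by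
        have := (abs_le.1 (hb _ (hYm t ht))).2
        linarith
      have hYd : HasDerivAt Y (-(2 * (Y t - γ (Y t) * γ₁ (Y t))))⁻¹ t := by
        refine HasDerivAt.of_local_left_inverse (hYc t ht) (hτd (Y t)).neg (by linarith) ?_
        filter_upwards [isOpen_Ioo.mem_nhds ht, Iio_mem_nhds h] with s hs hs0
        have hs0' : s < 0 := hs0
        simp only [Pi.neg_apply]
        rw [hYτ s hs, max_eq_left (by linarith), neg_neg]
      refine ((hG (Y t)).comp t hYd).congr_deriv ?_
      simp only [hq]
      field_simp
    · subst h
      rw [hY0 0 le_rfl, hq0, neg_zero, hasDerivAt_iff_isLittleO, Asymptotics.isLittleO_iff]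
      intro c hc
      have hlim : Filter.Tendsto (fun s => 4 * A * Y s) (nhds 0) (nhds 0) := by
        have := ((hYc 0 ht).const_mul (4 * A)).tendsto
        simpa only [hY0 0 le_rfl, mul_zero] using this
      filter_upwards [isOpen_Ioo.mem_nhds ht, hlim.eventually (Iio_mem_nhds hc)] with s hs hsc
      have h1 := hYsq s hs 0 ht
      rw [hY0 0 le_rfl, sub_zero, sub_zero] at h1
      have hYs := (hYm s hs).1
      have h2 := (hj _ (hYm s hs)).2.2
      simp only [hY0 0 le_rfl, smul_eq_mul, mul_zero, zero_mul, sub_zero, Real.norm_eq_abs]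
      rw [abs_mul, abs_mul, abs_two, abs_of_nonneg hYs]
      calc 2 * Y s * |γ (Y s)| ≤ 2 * Y s * (A * (2 * |s|)) := by
            gcongr
            exact h2.trans (by gcongr)
        _ = 4 * A * Y s * |s| := by ring
        _ ≤ c * |s| := by gcongr
    · rw [hY0 t h.le, hq0, neg_zero]
      refine (hasDerivAt_const t (0 : ℝ)).congr_of_eventuallyEq ?_
      filter_upwards [Ioi_mem_nhds h] with s hs
      rw [hY0 s (le_of_lt hs)]; simp
  refine ⟨δ, hδ0, fun t => 2 * Y t * γ (Y t), fun t ht => by simp [hY0 t ht], ?_,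
    fun t ht => (hder t ht).differentiableAt.differentiableWithinAt, L * √2, by positivity, ?_⟩
  · intro x hx hxδ
    have hxm : x ∈ Set.Icc 0 b := ⟨hx, hxδ.trans hδb⟩
    have hnn : 0 ≤ τ x := by simpa [hτ0] using hτmono h0mem hxm hx
    have : Y (-(x ^ 2 - γ x ^ 2)) = x := by
      change X (max (- -(τ x)) 0) = x
      rw [neg_neg, max_eq_left hnn, hXτ x hxm]
    simp only [this]
  · intro s hs t ht
    rw [(hder s hs).deriv, (hder t ht).deriv, ← Real.sqrt_eq_rpow,
      show -q (Y s) - -q (Y t) = -(q (Y s) - q (Y t)) by ring, abs_neg]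
    calc |q (Y s) - q (Y t)| ≤ L * |Y s - Y t| := hLip _ (hYm s hs) _ (hYm t ht)
      _ ≤ L * √(2 * |s - t|) := by gcongr; exact hYh s hs t ht
      _ = L * √2 * √|s - t| := by rw [Real.sqrt_mul (by norm_num)]; ring

/-- Corner-straightening: let `γ` be smooth and even with `γ(0) = 0`
and `γ(x) = a₂x² + O(x⁴)`.  Under `ζ = x + iy ↦ w = -iζ²`:
(i) the half-axis `{iy : y ≥ 0}` is mapped to itself;
(ii) the curve `x ↦ x + iγ(x)` (`x ≥ 0`) is mapped to a curve which, parameterized by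
`t = -(x² - γ(x)²) = -(x² - a₂²x⁴ + O(x⁶)) < 0`, equals `it + 2a₂|t|^{3/2} + O(|t|^{5/2})`;
(iii) consequently the combined image boundary curve is the graph `t ↦ (μ(t), t)` of a
`C^{1,1/2}` function `μ` vanishing for `t ≥ 0`. -/
theorem stmt_16 (γ : ℝ → ℝ) (a₂ : ℝ)
    (hsmooth : ContDiff ℝ (⊤ : ℕ∞) γ)
    (heven : ∀ x : ℝ, γ (-x) = γ x)
    (h0 : γ 0 = 0)
    (htaylor : ∃ C₄ > (0 : ℝ), ∃ δ₄ > (0 : ℝ), ∀ x : ℝ, |x| ≤ δ₄ →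
      |γ x - a₂ * x ^ 2| ≤ C₄ * x ^ 4) :
    (∀ y : ℝ, 0 ≤ y →
        ((-I) * (I * (y : ℂ)) ^ 2).re = 0 ∧ 0 ≤ ((-I) * (I * (y : ℂ)) ^ 2).im) ∧
    (∃ δ > (0 : ℝ), ∃ Cb > (0 : ℝ), ∀ x : ℝ, 0 ≤ x → x ≤ δ →
        ((-I) * ((x : ℂ) + I * (γ x : ℂ)) ^ 2).im = -(x ^ 2 - (γ x) ^ 2) ∧
        |((-I) * ((x : ℂ) + I * (γ x : ℂ)) ^ 2).re
            - 2 * a₂ * |x ^ 2 - (γ x) ^ 2| ^ ((3 : ℝ) / 2)|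
          ≤ Cb * |x ^ 2 - (γ x) ^ 2| ^ ((5 : ℝ) / 2)) ∧
    (∃ δ > (0 : ℝ), ∃ μ : ℝ → ℝ,
        (∀ t : ℝ, 0 ≤ t → μ t = 0) ∧
        (∀ x : ℝ, 0 ≤ x → x ≤ δ →
          μ (-(x ^ 2 - (γ x) ^ 2)) = ((-I) * ((x : ℂ) + I * (γ x : ℂ)) ^ 2).re) ∧
        DifferentiableOn ℝ μ (Set.Ioo (-δ) δ) ∧
        ∃ Ch > (0 : ℝ), ∀ s ∈ Set.Ioo (-δ) δ, ∀ t ∈ Set.Ioo (-δ) δ,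
          |deriv μ s - deriv μ t| ≤ Ch * |s - t| ^ ((1 : ℝ) / 2)) := by
  have hre : ∀ x c : ℝ, ((-I) * ((x : ℂ) + I * (c : ℂ)) ^ 2).re = 2 * x * c := by
    intro x c
    simp [pow_two]
    ring
  have him : ∀ x c : ℝ, ((-I) * ((x : ℂ) + I * (c : ℂ)) ^ 2).im = -(x ^ 2 - c ^ 2) := by
    intro x c
    simp [pow_two]
  obtain ⟨γ₁, γ₂, A, hA, hd, hd1, hj'⟩ := exists_even_jet_bounds hsmooth heven h0
  have hb1 : 1 / (2 * A) ≤ 1 := by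
    rw [div_le_one (by linarith)]; linarith
  have hj : ∀ x ∈ Set.Icc (0 : ℝ) (1 / (2 * A)),
      |γ₂ x| ≤ A ∧ |γ₁ x| ≤ A * x ∧ |γ x| ≤ A * x ^ 2 := fun x hx =>
    hj' x ⟨hx.1, hx.2.trans hb1⟩
  refine ⟨fun y hy => ?_, ?_, ?_⟩
  · have h1 := hre 0 y
    have h2 := him 0 y
    simp only [ofReal_zero, zero_add] at h1 h2
    rw [h1, h2]
    exact ⟨by ring, by nlinarith [sq_nonneg y]⟩
  · obtain ⟨C, hC, δ, hδ, hT⟩ := htaylor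
    refine ⟨min δ (1 / (2 * A)), by positivity, 32 * (2 * C + 6 * |a₂| * A ^ 2), by positivity,
      fun x hx hxδ => ⟨him x _, ?_⟩⟩
    rw [hre]
    have hxm : x ∈ Set.Icc (0 : ℝ) (1 / (2 * A)) := ⟨hx, hxδ.trans (min_le_right _ _)⟩
    have hA2 := (hj x hxm).2.2
    refine abs_sub_rpow_three_halves_le hx hC.le hA2
      (hT x (by rw [abs_of_nonneg hx]; exact hxδ.trans (min_le_left _ _))) ?_
    have hAx : A * x ≤ 1 / 2 := by
      have := mul_le_mul_of_nonneg_left hxm.2 (by linarith : (0 : ℝ) ≤ A)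
      have e : A * (1 / (2 * A)) = 1 / 2 := by field_simp
      linarith
    have hc : γ x ^ 2 ≤ (x / 2) ^ 2 := by
      rw [← sq_abs]
      gcongr
      calc |γ x| ≤ A * x * x := by linarith
        _ ≤ 1 / 2 * x := by gcongr
        _ = x / 2 := by ring
    nlinarith [sq_nonneg x]
  · simp only [hre]
    exact exists_graph_function hA h0 hd hd1 hj
end
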